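/- Let A_1, …, A_m ∈ M_n be Hermitian matrices and let C ∈ M_n be a non-scalar Hermitian matrix with γ(C) ≤ ⌊n/2⌋. If conv W_C(A_1, …, A_m) is polyhedral, then W_{Ĉ}(A_1, …, A_m) is polyhedral for every non-scalar Hermitian Ĉ ∈ M_n with γ(Ĉ) ≤ γ(C); in particular, W_C(A_1, …, A_m) itself is polyhedral. -/

import Mathlib

open Matrix

/-- The joint `C`-numerical range of a tuple of Hermitian matrices, regarded as a
subset of `ℝ^m`. -/
noncomputable def jointCNumRangeR {N m : ℕ} (C : Matrix (Fin N) (Fin N) ℂ)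
    (A : Fin m → Matrix (Fin N) (Fin N) ℂ) : Set (Fin m → ℝ) :=
  { p | ∃ U ∈ Matrix.unitaryGroup (Fin N) ℂ,
      ∀ j, (p j : ℂ) = (C * (star U * A j * U)).trace }

/-- A subset of a real vector space is polyhedral if it is the convex hull of a finite set. -/
def IsPolyhedral {E : Type*} [AddCommGroup E] [Module ℝ E] (S : Set E) : Prop :=
  ∃ F : Set E, F.Finite ∧ S = convexHull ℝ F

/-- The eigenvalues of a Hermitian matrix, arranged in descending order
`λ₁(H) ≥ … ≥ λₙ(H)` (junk value `0` if `H` is not Hermitian). -/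
noncomputable def eigDesc {N : ℕ} (H : Matrix (Fin N) (Fin N) ℂ) : Fin N → ℝ :=
  if h : H.IsHermitian then
    fun i => (h.eigenvalues ∘ Tuple.sort h.eigenvalues) i.rev
  else 0

/-- For a Hermitian matrix `C` with eigenvalues `c₁ ≥ … ≥ c_N` (1-based),
`γ(C) = max({j ≤ N/2 : c_j > c_{j+1}} ∪ {N − j ≤ N/2 : c_j > c_{j+1}})`. -/
noncomputable def gammaC {N : ℕ} (C : Matrix (Fin N) (Fin N) ℂ) : ℕ :=
  sSup { t : ℕ | ∃ (j : ℕ) (h1 : 1 ≤ j) (h2 : j < N),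
    eigDesc C ⟨j - 1, by omega⟩ > eigDesc C ⟨j, h2⟩ ∧
    ((t = j ∧ 2 * j ≤ N) ∨ (t = N - j ∧ 2 * (N - j) ≤ N)) }

section Pencil

variable {E : Type*} [NormedAddCommGroup E] [InnerProductSpace ℂ E]

/-- The real part of the quadratic form of `H`. -/
noncomputable def quadForm (H : E →ₗ[ℂ] E) (x : E) : ℝ := (inner ℂ x (H x)).re

/-- The values of the quadratic form of `H` on `Lᗮ` dominate its values on `L`. -/
def IsTopSplit (H : E →ₗ[ℂ] E) (L : Submodule ℂ E) : Prop :=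
  ∀ x ∈ Lᗮ, ∀ y ∈ L, quadForm H y * ‖x‖ ^ 2 ≤ quadForm H x * ‖y‖ ^ 2

theorem quadForm_neg (H : E →ₗ[ℂ] E) (x : E) : quadForm (-H) x = -quadForm H x := by
  simp [quadForm]

theorem quadForm_of_eigen {H : E →ₗ[ℂ] E} {x : E} {β : ℝ} (h : H x = (β : ℂ) • x) :
    quadForm H x = β * ‖x‖ ^ 2 := by
  rw [quadForm, h, inner_smul_right, Complex.re_ofReal_mul, inner_self_eq_norm_sq_to_K]
  norm_cast

theorem disjoint_of_quadForm {H : E →ₗ[ℂ] E} {M₁ M₂ : Submodule ℂ E} {β₁ β₂ : ℝ} (hβ : β₁ < β₂)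
    (h₁ : ∀ x ∈ M₁, quadForm H x ≤ β₁ * ‖x‖ ^ 2) (h₂ : ∀ x ∈ M₂, β₂ * ‖x‖ ^ 2 ≤ quadForm H x) :
    Disjoint M₁ M₂ := by
  rw [Submodule.disjoint_def]
  intro x hx₁ hx₂
  by_contra hx
  have : 0 < ‖x‖ ^ 2 := by positivity
  nlinarith [h₁ x hx₁, h₂ x hx₂]

theorem mem_orthogonal_of_symmetric {H : E →ₗ[ℂ] E} (hH : H.IsSymmetric) {L : Submodule ℂ E}
    (hL : ∀ x ∈ L, H x ∈ L) {x : E} (hx : x ∈ Lᗮ) : H x ∈ Lᗮ := by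
  rw [Submodule.mem_orthogonal] at hx ⊢
  intro u hu
  rw [← hH u x]
  exact hx _ (hL u hu)

variable [FiniteDimensional ℂ E]

theorem exists_real_eigenvector {H : E →ₗ[ℂ] E} (hH : H.IsSymmetric) {S : Submodule ℂ E}
    (hS : ∀ x ∈ S, H x ∈ S) (hne : S ≠ ⊥) :
    ∃ (β : ℝ) (x : E), x ∈ S ∧ x ≠ 0 ∧ H x = (β : ℂ) • x := by
  have : Nontrivial S := Submodule.nontrivial_iff_ne_bot.2 hne
  obtain ⟨c, hc⟩ := Module.End.exists_eigenvalue (H.restrict hS)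
  have hreal := (hH.restrict_invariant hS).conj_eigenvalue_eq_self hc
  obtain ⟨x, hx⟩ := hc.exists_hasEigenvector
  refine ⟨c.re, x, x.2, by simpa using hx.2, ?_⟩
  have := congrArg Subtype.val hx.apply_eq_smul
  rw [Complex.conj_eq_iff_re.1 hreal]
  simpa using this

theorem scalar_on_of_unique_eigenvalue {H : E →ₗ[ℂ] E} (hH : H.IsSymmetric) {S : Submodule ℂ E}
    (hS : ∀ x ∈ S, H x ∈ S)
    (huniq : ∀ (β₁ β₂ : ℝ) (x₁ x₂ : E), x₁ ∈ S → x₂ ∈ S → x₁ ≠ 0 → x₂ ≠ 0 →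
      H x₁ = (β₁ : ℂ) • x₁ → H x₂ = (β₂ : ℂ) • x₂ → ¬ β₁ < β₂) :
    ∃ β : ℝ, ∀ x ∈ S, H x = (β : ℂ) • x := by
  by_cases hne : S = ⊥
  · refine ⟨0, fun x hx => ?_⟩
    rw [hne, Submodule.mem_bot] at hx
    simp [hx]
  obtain ⟨β, x₀, hx₀, hx₀', hβ⟩ := exists_real_eigenvector hH hS hne
  refine ⟨β, ?_⟩
  set K := Module.End.eigenspace H (β : ℂ) with hK
  have hKinv : ∀ x ∈ K, H x ∈ K := by
    intro x hx
    have := Module.End.mem_eigenspace_iff.1 hx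
    rw [this]
    exact K.smul_mem _ hx
  have hSinf : S ⊓ (S ⊓ K)ᗮ = ⊥ := by
    by_contra hne'
    obtain ⟨β', x, hx, hx', hβ'⟩ := exists_real_eigenvector hH
      (S := S ⊓ (S ⊓ K)ᗮ) (fun x hx => ⟨hS x hx.1, mem_orthogonal_of_symmetric hH
        (L := S ⊓ K) (fun y hy => ⟨hS y hy.1, hKinv y hy.2⟩) hx.2⟩) hne'
    have h1 := huniq β β' x₀ x hx₀ hx.1 hx₀' hx' hβ hβ'
    have h2 := huniq β' β x x₀ hx.1 hx₀ hx' hx₀' hβ' hβ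
    obtain rfl : β = β' := le_antisymm (not_lt.1 h2) (not_lt.1 h1)
    have hxK : x ∈ S ⊓ K := ⟨hx.1, Module.End.mem_eigenspace_iff.2 hβ'⟩
    exact hx' (by simpa using (Submodule.mem_orthogonal _ _).1 hx.2 x hxK)
  intro x hx
  obtain ⟨y, hy, z, hz, hxyz⟩ := Submodule.exists_add_mem_mem_orthogonal (K := S ⊓ K) x
  have hzS : z ∈ S := by
    have : z = x - y := by rw [hxyz]; abel
    rw [this]; exact S.sub_mem hx hy.1
  have hz0 : z ∈ S ⊓ (S ⊓ K)ᗮ := ⟨hzS, hz⟩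
  rw [hSinf, Submodule.mem_bot] at hz0
  rw [hxyz, hz0, add_zero]
  exact Module.End.mem_eigenspace_iff.1 hy.2

/-- If an eigenvector of `H` is not contained in the lower part `L` of a split, then its eigenvalue
bounds the form of `H` on a subspace strictly larger than `L`. -/
theorem IsTopSplit.exists_bounded {H : E →ₗ[ℂ] E} (hH : H.IsSymmetric) {L : Submodule ℂ E}
    (hL : ∀ x ∈ L, H x ∈ L) (hs : IsTopSplit H L) {x : E} {β : ℝ} (hx : H x = (β : ℂ) • x)
    (hxL : x ∉ L) :
    ∃ M : Submodule ℂ E, Module.finrank ℂ L + 1 ≤ Module.finrank ℂ M ∧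
      ∀ z ∈ M, quadForm H z ≤ β * ‖z‖ ^ 2 := by
  obtain ⟨y, hy, x', hx', hxy⟩ := Submodule.exists_add_mem_mem_orthogonal (K := L) x
  have hx0 : x' ≠ 0 := by
    rintro rfl
    exact hxL (by rw [hxy, add_zero]; exact hy)
  have heig : H x' = (β : ℂ) • x' := by
    have h1 : H y - (β : ℂ) • y = (β : ℂ) • x' - H x' := by
      rw [hxy, map_add, smul_add] at hx
      rw [sub_eq_sub_iff_add_eq_add, hx]; abel
    have h2 : H y - (β : ℂ) • y ∈ L := L.sub_mem (hL y hy) (L.smul_mem _ hy)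
    have h3 : H y - (β : ℂ) • y ∈ Lᗮ := by
      rw [h1]
      exact Submodule.sub_mem _ (Submodule.smul_mem _ _ hx') (mem_orthogonal_of_symmetric hH hL hx')
    have h4 : H y - (β : ℂ) • y = 0 := by
      have := (Submodule.mem_orthogonal _ _).1 h3 _ h2
      simpa using this
    rw [h1] at h4
    exact (sub_eq_zero.1 h4).symm
  refine ⟨L ⊔ Submodule.span ℂ {x'}, ?_, ?_⟩
  · have hlt : L < L ⊔ Submodule.span ℂ {x'} := by
      refine lt_of_le_of_ne le_sup_left fun h => hx0 ?_
      have hmem : x' ∈ L := by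
        rw [h]
        exact Submodule.mem_sup_right (Submodule.mem_span_singleton_self x')
      simpa using (Submodule.mem_orthogonal _ _).1 hx' _ hmem
    exact Submodule.finrank_lt_finrank_of_lt hlt
  · intro z hz
    obtain ⟨l, hl, w, hw, rfl⟩ := Submodule.mem_sup.1 hz
    obtain ⟨a, rfl⟩ := Submodule.mem_span_singleton.1 hw
    have hHw : H (a • x') = (β : ℂ) • (a • x') := by rw [map_smul, heig, smul_comm]
    have hw' : a • x' ∈ Lᗮ := Submodule.smul_mem _ _ hx'
    generalize a • x' = w at hHw hw'
    have hq : quadForm H l ≤ β * ‖l‖ ^ 2 := by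
      have h1 := hs x' hx' l hl
      rw [quadForm_of_eigen heig] at h1
      have : 0 < ‖x'‖ ^ 2 := by positivity
      nlinarith
    have hlw : inner ℂ l w = 0 := (Submodule.mem_orthogonal _ _).1 hw' l hl
    have hwl : inner ℂ w (H l) = 0 := (Submodule.mem_orthogonal' _ _).1 hw' _ (hL l hl)
    have hlw' : inner ℂ l (H w) = 0 := by rw [hHw, inner_smul_right, hlw, mul_zero]
    have e1 : quadForm H (l + w) = quadForm H l + quadForm H w := by
      simp only [quadForm, map_add, inner_add_left, inner_add_right, hwl, hlw']
      simp
    have e2 : ‖l + w‖ ^ 2 = ‖l‖ ^ 2 + ‖w‖ ^ 2 := by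
      rw [sq, sq, sq]; exact norm_add_sq_eq_norm_sq_add_norm_sq_of_inner_eq_zero _ _ hlw
    rw [e1, e2, quadForm_of_eigen hHw]
    linarith

theorem scalar_on_of_split_split {H : E →ₗ[ℂ] E} (hH : H.IsSymmetric) {L L' S : Submodule ℂ E}
    (hL : ∀ x ∈ L, H x ∈ L) (hs : IsTopSplit H L) (hs' : IsTopSplit H L')
    (hrank : Module.finrank ℂ L = Module.finrank ℂ L') (hS : ∀ x ∈ S, H x ∈ S)
    (hSL : Disjoint S L) (hSL' : S ≤ L') :
    ∃ β : ℝ, ∀ x ∈ S, H x = (β : ℂ) • x := by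
  refine scalar_on_of_unique_eigenvalue hH hS fun β₁ β₂ x₁ x₂ hx₁ hx₂ h₁ h₂ he₁ he₂ hlt => ?_
  obtain ⟨M, hM, hMq⟩ := hs.exists_bounded hH hL he₁
    fun h => h₁ ((Submodule.disjoint_def.1 hSL) _ hx₁ h)
  have hd := disjoint_of_quadForm (M₂ := L'ᗮ) hlt hMq fun x hx => by
    have := hs' x hx x₂ (hSL' hx₂)
    rw [quadForm_of_eigen he₂] at this
    have : 0 < ‖x₂‖ ^ 2 := by positivity
    nlinarith
  have := Submodule.finrank_add_finrank_le_of_disjoint hd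
  have := Submodule.finrank_add_finrank_orthogonal L'
  omega

theorem scalar_on_of_split_neg_split {H : E →ₗ[ℂ] E} (hH : H.IsSymmetric) {L L' S : Submodule ℂ E}
    (hL : ∀ x ∈ L, H x ∈ L) (hL' : ∀ x ∈ L', H x ∈ L') (hs : IsTopSplit H L)
    (hs' : IsTopSplit (-H) L')
    (hrank : Module.finrank ℂ E ≤ Module.finrank ℂ L + Module.finrank ℂ L')
    (hS : ∀ x ∈ S, H x ∈ S) (hSL : Disjoint S L) (hSL' : Disjoint S L') :
    ∃ β : ℝ, ∀ x ∈ S, H x = (β : ℂ) • x := by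
  refine scalar_on_of_unique_eigenvalue hH hS fun β₁ β₂ x₁ x₂ hx₁ hx₂ h₁ h₂ he₁ he₂ hlt => ?_
  obtain ⟨M, hM, hMq⟩ := hs.exists_bounded hH hL he₁
    fun h => h₁ ((Submodule.disjoint_def.1 hSL) _ hx₁ h)
  obtain ⟨M', hM', hMq'⟩ := hs'.exists_bounded (fun x y => by simp [hH x y])
    (fun x hx => L'.neg_mem (hL' x hx))
    (x := x₂) (β := -β₂) (by simp [he₂])
    fun h => h₂ ((Submodule.disjoint_def.1 hSL') _ hx₂ h)
  have hd := disjoint_of_quadForm (M₂ := M') hlt hMq fun x hx => by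
    have := hMq' x hx
    rw [quadForm_neg] at this
    linarith
  have := Submodule.finrank_add_finrank_le_of_disjoint hd
  omega

end Pencil

section SplitFan

variable {E : Type*} [NormedAddCommGroup E] [InnerProductSpace ℂ E] {m : ℕ}

/-- The linear pencil `θ ↦ ∑ⱼ θⱼ Tⱼ`. -/
noncomputable def pencil (T : Fin m → E →ₗ[ℂ] E) (θ : Fin m → ℝ) : E →ₗ[ℂ] E :=
  ∑ j, (θ j : ℂ) • T j

theorem pencil_apply (T : Fin m → E →ₗ[ℂ] E) (θ : Fin m → ℝ) (x : E) :
    pencil T θ x = ∑ j, (θ j : ℂ) • T j x := by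
  simp [pencil]

theorem pencil_add (T : Fin m → E →ₗ[ℂ] E) (θ η : Fin m → ℝ) :
    pencil T (θ + η) = pencil T θ + pencil T η := by
  simp [pencil, add_smul, Finset.sum_add_distrib]

theorem pencil_smul (T : Fin m → E →ₗ[ℂ] E) (a : ℝ) (θ : Fin m → ℝ) :
    pencil T (a • θ) = (a : ℂ) • pencil T θ := by
  simp [pencil, Finset.smul_sum, smul_smul, -Complex.coe_smul]

theorem pencil_neg (T : Fin m → E →ₗ[ℂ] E) (θ : Fin m → ℝ) :
    pencil T (-θ) = -pencil T θ := by
  simp [pencil]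

theorem pencil_single (T : Fin m → E →ₗ[ℂ] E) (j : Fin m) :
    pencil T (Pi.single j 1) = T j := by
  rw [pencil, Finset.sum_eq_single j]
  · simp
  · intro i _ hi; simp [Pi.single_eq_of_ne hi]
  · simp

theorem pencil_isSymmetric {T : Fin m → E →ₗ[ℂ] E} (hT : ∀ j, (T j).IsSymmetric)
    (θ : Fin m → ℝ) : (pencil T θ).IsSymmetric := by
  intro x y
  simp [pencil_apply, sum_inner, inner_sum, inner_smul_left, inner_smul_right, hT _ x y,
    -Complex.coe_smul]

theorem pencil_mem {T : Fin m → E →ₗ[ℂ] E} {S : Submodule ℂ E} (hS : ∀ j, ∀ x ∈ S, T j x ∈ S)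
    (θ : Fin m → ℝ) : ∀ x ∈ S, pencil T θ x ∈ S := by
  intro x hx
  rw [pencil_apply]
  exact S.sum_mem fun j _ => S.smul_mem _ (hS j x hx)

/-- A finite closed cover of the parameter space of a pencil by sets with nonempty algebraic
interior, on each of which the same common invariant subspace of codimension `k` is the lower part
of a split of the pencil. -/
structure SplitFan (T : Fin m → E →ₗ[ℂ] E) (k : ℕ) where
  ι : Type
  finite : Finite ι
  N : ι → Set (Fin m → ℝ)
  L : ι → Submodule ℂ E
  isClosed : ∀ w, IsClosed (N w)
  cover : ∀ θ, ∃ w, θ ∈ N w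
  rank : ∀ w, Module.finrank ℂ (L w) + k = Module.finrank ℂ E
  inv : ∀ w j, ∀ x ∈ L w, T j x ∈ L w
  split : ∀ w, ∀ θ ∈ N w, IsTopSplit (pencil T θ) (L w)
  fat : ∀ w, ∃ ν ∈ N w, ∀ μ, ∃ ε > 0, ν + (ε : ℝ) • μ ∈ N w

/-- A common eigenvector with real eigenvalues. -/
def IsCommonEigenvector (T : Fin m → E →ₗ[ℂ] E) (x : E) : Prop :=
  x ≠ 0 ∧ ∃ a : Fin m → ℝ, ∀ j, T j x = (a j : ℂ) • x

theorem isCommonEigenvector_of_pencil {T : Fin m → E →ₗ[ℂ] E} {x : E} (hx : x ≠ 0)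
    (h : ∀ μ, ∃ a : ℝ, pencil T μ x = (a : ℂ) • x) : IsCommonEigenvector T x := by
  choose a ha using h
  refine ⟨hx, fun j => a (Pi.single j 1), fun j => ?_⟩
  rw [← ha, pencil_single]

variable {T : Fin m → E →ₗ[ℂ] E} {k : ℕ}

theorem SplitFan.exists_nonscalar (F : SplitFan T k) {S : Submodule ℂ E} (v : F.ι)
    (hns : ¬ ∀ μ, ∃ β : ℝ, ∀ x ∈ S, pencil T μ x = (β : ℂ) • x) :
    ∃ ν ∈ F.N v, ¬ ∃ β : ℝ, ∀ x ∈ S, pencil T ν x = (β : ℂ) • x := by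
  by_contra! hall
  apply hns
  intro μ
  obtain ⟨ν, hν, hfat⟩ := F.fat v
  obtain ⟨ε, hε, hεN⟩ := hfat μ
  obtain ⟨β, hβ⟩ := hall ν hν
  obtain ⟨β', hβ'⟩ := hall _ hεN
  refine ⟨(β' - β) / ε, fun x hx => ?_⟩
  have h := hβ' x hx
  rw [pencil_add, pencil_smul, LinearMap.add_apply, hβ x hx, LinearMap.smul_apply] at h
  have hε' : (ε : ℂ) ≠ 0 := by exact_mod_cast hε.ne'
  have h2 : (ε : ℂ) • pencil T μ x = ((β' : ℂ) - β) • x := by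
    rw [sub_smul, ← h]; abel
  rw [← inv_smul_smul₀ hε' (pencil T μ x), h2, smul_smul]
  push_cast
  congr 1
  field_simp

variable [FiniteDimensional ℂ E]

/-- A minimal common invariant subspace not contained in the lower part of some cell of a split fan
contains a common eigenvector. -/
theorem SplitFan.exists_commonEigenvector_of_minimal (F : SplitFan T k)
    (hT : ∀ j, (T j).IsSymmetric) (hk : 2 * k ≤ Module.finrank ℂ E) {S : Submodule ℂ E}
    (hS : ∀ j, ∀ x ∈ S, T j x ∈ S) (hne : S ≠ ⊥)
    (hmin : ∀ S' ≤ S, (∀ j, ∀ x ∈ S', T j x ∈ S') → S' = ⊥ ∨ S' = S)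
    (v : F.ι) (hv : ¬ S ≤ F.L v) : ∃ x ∈ S, IsCommonEigenvector T x := by
  have := F.finite
  have hdich : ∀ w, ¬ S ≤ F.L w → Disjoint S (F.L w) := by
    intro w hw
    rcases hmin (S ⊓ F.L w) inf_le_left
      (fun j x hx => ⟨hS j x hx.1, F.inv w j x hx.2⟩) with h | h
    · exact disjoint_iff.2 h
    · exact absurd (inf_eq_left.1 h) hw
  by_cases hns : ∀ μ, ∃ β : ℝ, ∀ x ∈ S, pencil T μ x = (β : ℂ) • x
  · obtain ⟨x, hx, hx0⟩ := S.exists_mem_ne_zero_of_ne_bot hne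
    refine ⟨x, hx, isCommonEigenvector_of_pencil hx0 fun μ => ?_⟩
    obtain ⟨β, hβ⟩ := hns μ
    exact ⟨β, hβ x hx⟩
  obtain ⟨ν, hν, hνns⟩ := F.exists_nonscalar v hns
  obtain ⟨β, x, hx, hx0, hβ⟩ := exists_real_eigenvector (pencil_isSymmetric hT ν)
    (pencil_mem hS ν) hne
  refine ⟨x, hx, isCommonEigenvector_of_pencil hx0 fun μ => ?_⟩
  let path : ℝ → (Fin m → ℝ) := fun t => t • ν + (1 - |t|) • μ
  have hpath : Continuous path := by fun_prop
  have hclosed : ∀ p : F.ι → Prop, IsClosed {t | ∃ w, p w ∧ path t ∈ F.N w} := by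
    intro p
    have : {t | ∃ w, p w ∧ path t ∈ F.N w} = ⋃ w : {w // p w}, path ⁻¹' F.N w := by
      ext t; simp
    rw [this]
    exact isClosed_iUnion_of_finite fun w => (F.isClosed w).preimage hpath
  obtain ⟨t, -, ⟨w, hw, htw⟩, ⟨w', hw', htw'⟩⟩ :=
    isPreconnected_closed_iff.1 (isPreconnected_Icc (a := (-1 : ℝ)) (b := 1))
      _ _ (hclosed fun w => ¬ S ≤ F.L w) (hclosed fun w => S ≤ F.L w) (by
        intro t _
        obtain ⟨w, hw⟩ := F.cover (path t)
        by_cases h : S ≤ F.L w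
        · exact Or.inr ⟨w, h, hw⟩
        · exact Or.inl ⟨w, h, hw⟩)
      ⟨1, by norm_num, v, hv, by simpa [path] using hν⟩ (by
        obtain ⟨w, hw⟩ := F.cover (-ν)
        refine ⟨-1, by norm_num, w, ?_, by simpa [path] using hw⟩
        by_contra h
        refine hνns (scalar_on_of_split_neg_split (pencil_isSymmetric hT ν)
          (pencil_mem (F.inv v) ν) (pencil_mem (F.inv w) ν) (F.split v ν hν)
          (by simpa [pencil_neg] using F.split w _ hw) ?_ (pencil_mem hS ν) (hdich v hv)
          (hdich w h))
        have := F.rank v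
        have := F.rank w
        omega)
  obtain ⟨γ, hγ⟩ := scalar_on_of_split_split (pencil_isSymmetric hT (path t))
    (pencil_mem (F.inv w) _) (F.split w _ htw) (F.split w' _ htw')
    (by have := F.rank w; have := F.rank w'; omega) (pencil_mem hS _) (hdich w hw) hw'
  have hγ' : ∀ y ∈ S, (t : ℂ) • pencil T ν y + ((1 - |t| : ℝ) : ℂ) • pencil T μ y
      = (γ : ℂ) • y := by
    intro y hy
    rw [← hγ y hy, pencil_add, pencil_smul, pencil_smul]
    rfl
  have hb : 1 - |t| ≠ 0 := by
    intro h0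
    have ht : t ≠ 0 := by
      rintro rfl
      simp at h0
    refine hνns ⟨γ / t, fun y hy => ?_⟩
    have h := hγ' y hy
    rw [h0] at h
    have ht' : (t : ℂ) ≠ 0 := by exact_mod_cast ht
    rw [← inv_smul_smul₀ ht' (pencil T ν y)]
    simp only [Complex.ofReal_zero, zero_smul, add_zero] at h
    rw [h, smul_smul]
    push_cast
    congr 1
    field_simp
  have hb' : ((1 - |t| : ℝ) : ℂ) ≠ 0 := by exact_mod_cast hb
  refine ⟨(γ - t * β) / (1 - |t|), ?_⟩
  have h := hγ' x hx
  rw [hβ] at h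
  rw [← inv_smul_smul₀ hb' (pencil T μ x), eq_sub_of_add_eq' h, smul_smul,
    ← sub_smul, smul_smul]
  push_cast
  congr 1
  push_cast at hb'
  field_simp

/-- A common invariant subspace without common eigenvectors is contained in the lower part of every
cell of a split fan. -/
theorem SplitFan.le_of_no_commonEigenvector (F : SplitFan T k)
    (hT : ∀ j, (T j).IsSymmetric) (hk : 2 * k ≤ Module.finrank ℂ E) {S : Submodule ℂ E}
    (hS : ∀ j, ∀ x ∈ S, T j x ∈ S) (hno : ∀ x ∈ S, ¬ IsCommonEigenvector T x) (v : F.ι) :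
    S ≤ F.L v := by
  by_contra hv
  set G := S ⊓ (S ⊓ F.L v)ᗮ with hG
  have hGinv : ∀ j, ∀ x ∈ G, T j x ∈ G := fun j x hx => ⟨hS j x hx.1,
    mem_orthogonal_of_symmetric (hT j) (L := S ⊓ F.L v)
      (fun y hy => ⟨hS j y hy.1, F.inv v j y hy.2⟩) hx.2⟩
  have hGL : Disjoint G (F.L v) := by
    rw [Submodule.disjoint_def]
    intro x hx hxL
    simpa using (Submodule.mem_orthogonal _ _).1 hx.2 x ⟨hx.1, hxL⟩
  have hGne : G ≠ ⊥ := by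
    intro h0
    apply hv
    intro x hx
    obtain ⟨y, hy, z, hz, hxyz⟩ := Submodule.exists_add_mem_mem_orthogonal (K := S ⊓ F.L v) x
    have hzG : z ∈ G := ⟨by
      have : z = x - y := by rw [hxyz]; abel
      rw [this]; exact S.sub_mem hx hy.1, hz⟩
    rw [h0, Submodule.mem_bot] at hzG
    rw [hxyz, hzG, add_zero]
    exact hy.2
  obtain ⟨M, ⟨hMne, hMG, hMinv⟩, hMmin⟩ := (wellFounded_lt (α := Submodule ℂ E)).has_min
    {M | M ≠ ⊥ ∧ M ≤ G ∧ ∀ j, ∀ x ∈ M, T j x ∈ M} ⟨G, hGne, le_rfl, hGinv⟩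
  obtain ⟨x, hx, hxe⟩ := F.exists_commonEigenvector_of_minimal hT hk hMinv hMne
    (fun S' hS' hinv => by
      by_contra! h
      exact hMmin S' ⟨h.1, hS'.trans hMG, hinv⟩ (lt_of_le_of_ne hS' h.2)) v
    (fun h => hMne (by
      rw [← le_bot_iff]
      exact hGL hMG h))
  exact hno x (hMG hx).1 hxe

end SplitFan

section Variation

variable {E : Type*} [NormedAddCommGroup E] [InnerProductSpace ℂ E] {κ : Type*}

theorem orthonormal_reflect {y : κ → E} (hy : Orthonormal ℂ y) {u : E} (hu : ‖u‖ = 1) {z : ℂ}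
    (hz : z + starRingEnd ℂ z + starRingEnd ℂ z * z = 0) :
    Orthonormal ℂ fun i => y i + (z * inner ℂ u (y i)) • u := by
  classical
  rw [orthonormal_iff_ite] at hy ⊢
  intro i j
  have huu : inner ℂ u u = (1 : ℂ) := by rw [inner_self_eq_norm_sq_to_K, hu]; simp
  simp only [inner_add_left, inner_add_right, inner_smul_left, inner_smul_right, huu, hy i j,
    map_mul, inner_conj_symm]
  linear_combination (inner ℂ (y i) u * inner ℂ u (y j)) * hz

theorem quadForm_add_smul {H : E →ₗ[ℂ] E} (hH : H.IsSymmetric) (x u : E) (s : ℂ) :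
    quadForm H (x + s • u) =
      quadForm H x + 2 * (s * inner ℂ x (H u)).re + ‖s‖ ^ 2 * quadForm H u := by
  have h1 : inner ℂ u (H x) = starRingEnd ℂ (inner ℂ x (H u)) := by
    rw [inner_conj_symm, hH]
  have h2 : (starRingEnd ℂ s * starRingEnd ℂ (inner ℂ x (H u))).re = (s * inner ℂ x (H u)).re := by
    rw [← map_mul, Complex.conj_re]
  have h3 : (s * (starRingEnd ℂ s * inner ℂ u (H u))).re = ‖s‖ ^ 2 * (inner ℂ u (H u)).re := by
    rw [← mul_assoc, Complex.mul_conj, Complex.re_ofReal_mul,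
      Complex.normSq_eq_norm_sq]
  simp only [quadForm, map_add, map_smul, inner_add_left, inner_add_right, inner_smul_left,
    inner_smul_right, mul_add, Complex.add_re, h1, h2, h3]
  ring

theorem quadForm_smul (H : E →ₗ[ℂ] E) (x : E) (s : ℂ) :
    quadForm H (s • x) = ‖s‖ ^ 2 * quadForm H x := by
  rw [quadForm, map_smul, inner_smul_left, inner_smul_right, ← mul_assoc,
    mul_comm (starRingEnd ℂ s), Complex.mul_conj, Complex.re_ofReal_mul,
      Complex.normSq_eq_norm_sq, quadForm]

variable [Fintype κ]

theorem exists_reflect_scalar (t : ℝ) : ∃ z : ℂ, z + starRingEnd ℂ z + starRingEnd ℂ z * z = 0 ∧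
    z.re = -2 * t ^ 2 / (1 + t ^ 2) ∧ z.im = 2 * t / (1 + t ^ 2) := by
  have : (1 + t ^ 2) ≠ 0 := by positivity
  refine ⟨⟨-2 * t ^ 2 / (1 + t ^ 2), 2 * t / (1 + t ^ 2)⟩, ?_, rfl, rfl⟩
  apply Complex.ext
  · simp
    field_simp
    ring
  · simp
    ring

/-- First and second order conditions satisfied by an orthonormal family maximizing a weighted sum
of values of a quadratic form. -/
theorem variation_of_maximal_unit {H : E →ₗ[ℂ] E} (hH : H.IsSymmetric) {y : κ → E}
    (hy : Orthonormal ℂ y) {c : κ → ℝ}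
    (hmax : ∀ y' : κ → E, Orthonormal ℂ y' →
      ∑ i, c i * quadForm H (y' i) ≤ ∑ i, c i * quadForm H (y i)) {u : E} (hu : ‖u‖ = 1) :
    (∑ i, c i * (inner ℂ u (y i) * inner ℂ (y i) (H u))).im = 0 ∧
      (∑ i, c i * ‖inner ℂ u (y i)‖ ^ 2) * quadForm H u ≤
        (∑ i, c i * (inner ℂ u (y i) * inner ℂ (y i) (H u))).re := by
  set q : ℂ := ∑ i, c i * (inner ℂ u (y i) * inner ℂ (y i) (H u)) with hq
  set g : ℝ := ∑ i, c i * ‖inner ℂ u (y i)‖ ^ 2 with hg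
  have key : ∀ t : ℝ, -t * q.im + t ^ 2 * (g * quadForm H u - q.re) ≤ 0 := by
    intro t
    obtain ⟨z, hz, hre, him⟩ := exists_reflect_scalar t
    have h1 := hmax _ (orthonormal_reflect hy hu hz)
    have h2 : ∑ i, c i * quadForm H (y i + (z * inner ℂ u (y i)) • u) =
        ∑ i, c i * quadForm H (y i) + 2 * (z * q).re + ‖z‖ ^ 2 * (g * quadForm H u) := by
      rw [hq, hg, Finset.mul_sum, Complex.re_sum, Finset.mul_sum, Finset.sum_mul, Finset.mul_sum,
        ← Finset.sum_add_distrib, ← Finset.sum_add_distrib]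
      refine Finset.sum_congr rfl fun i _ => ?_
      rw [quadForm_add_smul hH, norm_mul,
        show z * (c i * (inner ℂ u (y i) * inner ℂ (y i) (H u))) =
          c i * (z * inner ℂ u (y i) * inner ℂ (y i) (H u)) by ring, Complex.re_ofReal_mul]
      ring
    rw [h2, ← Complex.normSq_eq_norm_sq, Complex.normSq_apply, Complex.mul_re, hre, him] at h1
    have hpos : 0 < 1 + t ^ 2 := by positivity
    have h3 : 2 * (-2 * t ^ 2 / (1 + t ^ 2) * q.re - 2 * t / (1 + t ^ 2) * q.im) +
        (-2 * t ^ 2 / (1 + t ^ 2) * (-2 * t ^ 2 / (1 + t ^ 2)) +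
          2 * t / (1 + t ^ 2) * (2 * t / (1 + t ^ 2))) * (g * quadForm H u) =
        4 * (-t * q.im + t ^ 2 * (g * quadForm H u - q.re)) / (1 + t ^ 2) := by
      field_simp
      ring
    have h4 : 4 * (-t * q.im + t ^ 2 * (g * quadForm H u - q.re)) / (1 + t ^ 2) ≤ 0 := by
      rw [← h3]; linarith
    rw [div_le_iff₀ hpos] at h4
    linarith
  have him : q.im = 0 := by
    set d := g * quadForm H u - q.re
    by_contra h
    have hpos : 0 < 1 + |d| := by positivity
    have h1 := key (-q.im / (1 + |d|))
    have h2 : -(-q.im / (1 + |d|)) * q.im + (-q.im / (1 + |d|)) ^ 2 * d =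
        q.im ^ 2 * (1 + |d| + d) / (1 + |d|) ^ 2 := by
      field_simp
    rw [h2] at h1
    have h3 : 0 < q.im ^ 2 * (1 + |d| + d) / (1 + |d|) ^ 2 := by
      have := neg_abs_le d
      have h4 : 0 < 1 + |d| + d := by linarith
      positivity
    linarith
  refine ⟨him, ?_⟩
  have := key 1
  rw [him] at this
  linarith

theorem variation_of_maximal {H : E →ₗ[ℂ] E} (hH : H.IsSymmetric) {y : κ → E}
    (hy : Orthonormal ℂ y) {c : κ → ℝ}
    (hmax : ∀ y' : κ → E, Orthonormal ℂ y' →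
      ∑ i, c i * quadForm H (y' i) ≤ ∑ i, c i * quadForm H (y i)) (u : E) :
    (∑ i, c i * (inner ℂ u (y i) * inner ℂ (y i) (H u))).im = 0 ∧
      (∑ i, c i * ‖inner ℂ u (y i)‖ ^ 2) * quadForm H u ≤
        (∑ i, c i * (inner ℂ u (y i) * inner ℂ (y i) (H u))).re * ‖u‖ ^ 2 := by
  rcases eq_or_ne u 0 with rfl | hu
  · simp
  set v : E := ((‖u‖⁻¹ : ℝ) : ℂ) • u with hv
  have hnu : ‖u‖ ≠ 0 := norm_ne_zero_iff.2 hu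
  have hnv : ‖v‖ = 1 := by
    rw [hv, norm_smul, Complex.norm_real, norm_inv, norm_norm, inv_mul_cancel₀ hnu]
  have huv : u = (‖u‖ : ℂ) • v := by
    rw [hv, smul_smul, ← Complex.ofReal_mul, mul_inv_cancel₀ hnu, Complex.ofReal_one, one_smul]
  obtain ⟨h1, h2⟩ := variation_of_maximal_unit hH hy hmax hnv
  have e1 : ∑ i, c i * (inner ℂ u (y i) * inner ℂ (y i) (H u)) =
      ((‖u‖ ^ 2 : ℝ) : ℂ) * ∑ i, c i * (inner ℂ v (y i) * inner ℂ (y i) (H v)) := by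
    rw [Finset.mul_sum]
    refine Finset.sum_congr rfl fun i _ => ?_
    conv_lhs => rw [huv]
    rw [map_smul, inner_smul_left, inner_smul_right, Complex.conj_ofReal]
    push_cast
    ring
  have e2 : ∑ i, c i * ‖inner ℂ u (y i)‖ ^ 2 =
      ‖u‖ ^ 2 * ∑ i, c i * ‖inner ℂ v (y i)‖ ^ 2 := by
    rw [Finset.mul_sum]
    refine Finset.sum_congr rfl fun i _ => ?_
    conv_lhs => rw [huv]
    rw [inner_smul_left, norm_mul, Complex.conj_ofReal, Complex.norm_real, norm_norm]
    ring
  have e3 : quadForm H u = ‖u‖ ^ 2 * quadForm H v := by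
    conv_lhs => rw [huv]
    rw [quadForm_smul, Complex.norm_real, norm_norm]
  rw [e1, e2, e3, Complex.im_ofReal_mul, Complex.re_ofReal_mul, h1]
  refine ⟨mul_zero _, ?_⟩
  have : 0 ≤ ‖u‖ ^ 2 * ‖u‖ ^ 2 := by positivity
  nlinarith [mul_le_mul_of_nonneg_left h2 this]

theorem inner_eq_zero_of_maximal {H : E →ₗ[ℂ] E} (hH : H.IsSymmetric) {y : κ → E}
    (hy : Orthonormal ℂ y) {c : κ → ℝ}
    (hmax : ∀ y' : κ → E, Orthonormal ℂ y' →
      ∑ i, c i * quadForm H (y' i) ≤ ∑ i, c i * quadForm H (y i)) {i j : κ} (hij : c i ≠ c j) :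
    inner ℂ (y i) (H (y j)) = 0 := by
  classical
  have hne : i ≠ j := fun h => hij (by rw [h])
  have hsum : ∀ ω : ℂ, (ω * inner ℂ (y i) (H (y j))).im = 0 := by
    intro ω
    have h := (variation_of_maximal hH hy hmax (y i + ω • y j)).1
    rw [orthonormal_iff_ite] at hy
    have e : ∑ k, (c k : ℂ) * (inner ℂ (y i + ω • y j) (y k) *
        inner ℂ (y k) (H (y i + ω • y j))) =
        c i * inner ℂ (y i) (H (y i + ω • y j)) +
          c j * (starRingEnd ℂ ω * inner ℂ (y j) (H (y i + ω • y j))) := by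
      simp only [inner_add_left, inner_smul_left, hy]
      simp [add_mul, mul_add, Finset.sum_add_distrib, ite_mul]
      ring
    rw [e] at h
    have hji : inner ℂ (y j) (H (y i)) = starRingEnd ℂ (inner ℂ (y i) (H (y j))) := by
      rw [inner_conj_symm, hH]
    have hreal : ∀ x, (inner ℂ x (H x)).im = 0 := fun x =>
      Complex.conj_eq_iff_im.1 (by rw [inner_conj_symm, hH])
    simp only [map_add, map_smul, inner_add_right, inner_smul_right, hji, mul_add,
      Complex.add_im, Complex.im_ofReal_mul, hreal] at h
    have h2 : (starRingEnd ℂ ω * (ω * inner ℂ (y j) (H (y j)))).im = 0 := by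
      rw [← mul_assoc, mul_comm (starRingEnd ℂ ω), Complex.mul_conj, Complex.im_ofReal_mul, hreal,
        mul_zero]
    have h3 : (starRingEnd ℂ ω * starRingEnd ℂ (inner ℂ (y i) (H (y j)))).im =
        -(ω * inner ℂ (y i) (H (y j))).im := by
      rw [← map_mul, Complex.conj_im]
    rw [h2, h3] at h
    have h4 : (c i - c j) * (ω * inner ℂ (y i) (H (y j))).im = 0 := by linarith
    exact (mul_eq_zero.1 h4).resolve_left (sub_ne_zero.2 hij)
  have h1 := hsum 1
  have h2 := hsum Complex.I
  apply Complex.ext <;> simp_all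

end Variation

section Level

variable {E : Type*} [NormedAddCommGroup E] [InnerProductSpace ℂ E] {κ : Type*} [Fintype κ]

theorem quadForm_id (x : E) : quadForm LinearMap.id x = ‖x‖ ^ 2 := by
  rw [quadForm, LinearMap.id_apply, inner_self_eq_norm_sq_to_K]
  norm_cast

theorem quadForm_sum_of_orthogonal (H : E →ₗ[ℂ] E) {α : Type*} (s : Finset α) (v : α → E)
    (h : ∀ a b, a ≠ b → inner ℂ (v a) (H (v b)) = 0) :
    quadForm H (∑ a ∈ s, v a) = ∑ a ∈ s, quadForm H (v a) := by
  classical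
  simp only [quadForm, map_sum, sum_inner, inner_sum]
  rw [Complex.re_sum]
  refine Finset.sum_congr rfl fun a ha => ?_
  rw [Finset.sum_eq_single a]
  · intro b _ hb
    exact h _ _ hb
  · exact fun h => absurd ha h

variable (b : OrthonormalBasis κ ℂ E) (c : κ → ℝ)

/-- The component of `x` along the basis vectors of weight `a`. -/
noncomputable def levelPart (a : ℝ) (x : E) : E :=
  ∑ i with c i = a, inner ℂ (b i) x • b i

theorem sum_levelPart (x : E) :
    ∑ a ∈ Finset.univ.image c, levelPart b c a x = x := by
  simp only [levelPart]
  rw [Finset.sum_fiberwise_of_maps_to (fun i _ => Finset.mem_image_of_mem c (Finset.mem_univ i))]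
  exact b.sum_repr' x

theorem inner_levelPart (a : ℝ) (x : E) (i : κ) :
    inner ℂ (b i) (levelPart b c a x) = if c i = a then inner ℂ (b i) x else 0 := by
  classical
  simp [levelPart, b.inner_eq_ite]

variable {b c}

theorem inner_eq_zero_of_level {H : E →ₗ[ℂ] E}
    (hH : ∀ i j, c i ≠ c j → inner ℂ (b i) (H (b j)) = 0) {a₁ a₂ : ℝ} (ha : a₁ ≠ a₂) {x y : E}
    (hx : ∀ i, c i ≠ a₁ → inner ℂ (b i) x = 0) (hy : ∀ i, c i ≠ a₂ → inner ℂ (b i) y = 0) :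
    inner ℂ x (H y) = 0 := by
  rw [← b.sum_repr' x, ← b.sum_repr' y, map_sum, sum_inner]
  refine Finset.sum_eq_zero fun i _ => ?_
  rw [inner_sum]
  refine Finset.sum_eq_zero fun j _ => ?_
  rw [map_smul, inner_smul_left, inner_smul_right]
  by_cases h1 : c i = a₁
  · by_cases h2 : c j = a₂
    · rw [hH i j (by rw [h1, h2]; exact ha)]; simp
    · rw [hy j h2]; simp
  · rw [hx i h1]; simp

theorem quadForm_eq_sum_levelPart {H : E →ₗ[ℂ] E}
    (hH : ∀ i j, c i ≠ c j → inner ℂ (b i) (H (b j)) = 0) (x : E) :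
    quadForm H x = ∑ a ∈ Finset.univ.image c, quadForm H (levelPart b c a x) := by
  conv_lhs => rw [← sum_levelPart b c x]
  refine quadForm_sum_of_orthogonal H _ _ fun a₁ a₂ ha => ?_
  refine inner_eq_zero_of_level hH ha ?_ ?_ <;>
  · intro i hi
    rw [inner_levelPart, if_neg hi]

theorem norm_sq_eq_sum_levelPart (x : E) :
    ‖x‖ ^ 2 = ∑ a ∈ Finset.univ.image c, ‖levelPart b c a x‖ ^ 2 := by
  simp only [← quadForm_id]
  exact quadForm_eq_sum_levelPart (fun i j hij => b.orthonormal.2 (fun h => hij (by rw [h]))) x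

theorem level_le_of_maximal {H : E →ₗ[ℂ] E} (hH : H.IsSymmetric)
    (hmax : ∀ y' : κ → E, Orthonormal ℂ y' →
      ∑ i, c i * quadForm H (y' i) ≤ ∑ i, c i * quadForm H (b i)) {a₁ a₂ : ℝ} (ha : a₂ < a₁)
    {x y : E} (hx : ∀ i, c i ≠ a₁ → inner ℂ (b i) x = 0)
    (hy : ∀ i, c i ≠ a₂ → inner ℂ (b i) y = 0) :
    quadForm H y * ‖x‖ ^ 2 ≤ quadForm H x * ‖y‖ ^ 2 := by
  rcases eq_or_ne x 0 with rfl | hx0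
  · simp [quadForm]
  rcases eq_or_ne y 0 with rfl | hy0
  · simp [quadForm]
  have hent : ∀ i j, c i ≠ c j → inner ℂ (b i) (H (b j)) = 0 := fun i j hij =>
    inner_eq_zero_of_maximal hH b.orthonormal hmax hij
  have hent' : ∀ i j, c i ≠ c j → inner ℂ (b i) (LinearMap.id (R := ℂ) (b j)) = 0 :=
    fun i j hij => b.orthonormal.2 (fun h => hij (by rw [h]))
  have hxy : inner ℂ x y = 0 := inner_eq_zero_of_level hent' ha.ne' hx hy
  have hyx : inner ℂ y x = 0 := inner_eq_zero_of_level hent' ha.ne hy hx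
  have hxHy : inner ℂ x (H y) = 0 := inner_eq_zero_of_level hent ha.ne' hx hy
  have hyHx : inner ℂ y (H x) = 0 := inner_eq_zero_of_level hent ha.ne hy hx
  set u : E := (‖y‖ : ℂ) • x + (‖x‖ : ℂ) • y with hu
  have hw : ∀ w : E, ∑ i, (c i : ℂ) * (inner ℂ u (b i) * inner ℂ (b i) w) =
      a₁ * ‖y‖ * inner ℂ x w + a₂ * ‖x‖ * inner ℂ y w := by
    intro w
    have hx' : ∀ i, (c i : ℂ) * inner ℂ x (b i) = a₁ * inner ℂ x (b i) := by
      intro i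
      by_cases h : c i = a₁
      · rw [h]
      · rw [← inner_conj_symm, hx i h]; simp
    have hy' : ∀ i, (c i : ℂ) * inner ℂ y (b i) = a₂ * inner ℂ y (b i) := by
      intro i
      by_cases h : c i = a₂
      · rw [h]
      · rw [← inner_conj_symm, hy i h]; simp
    rw [← b.sum_inner_mul_inner x w, ← b.sum_inner_mul_inner y w, Finset.mul_sum, Finset.mul_sum,
      ← Finset.sum_add_distrib]
    refine Finset.sum_congr rfl fun i _ => ?_
    rw [hu, inner_add_left, inner_smul_left, inner_smul_left, Complex.conj_ofReal,
      Complex.conj_ofReal]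
    linear_combination (‖y‖ : ℂ) * inner ℂ (b i) w * hx' i + ‖x‖ * inner ℂ (b i) w * hy' i
  obtain ⟨-, h⟩ := variation_of_maximal hH b.orthonormal hmax u
  have hxx : inner ℂ x x = ((‖x‖ ^ 2 : ℝ) : ℂ) := by rw [inner_self_eq_norm_sq_to_K]; norm_cast
  have hyy : inner ℂ y y = ((‖y‖ ^ 2 : ℝ) : ℂ) := by rw [inner_self_eq_norm_sq_to_K]; norm_cast
  have e1 : ((∑ i, c i * ‖inner ℂ u (b i)‖ ^ 2 : ℝ) : ℂ) =
      ((a₁ * ‖y‖ ^ 2 * ‖x‖ ^ 2 + a₂ * ‖x‖ ^ 2 * ‖y‖ ^ 2 : ℝ) : ℂ) := by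
    have := hw u
    rw [hu, inner_add_right, inner_add_right, inner_smul_right, inner_smul_right, inner_smul_right,
      inner_smul_right, hxy, hyx, hxx, hyy, ← hu] at this
    push_cast at this ⊢
    rw [show (a₁ * ‖y‖ ^ 2 * ‖x‖ ^ 2 + a₂ * ‖x‖ ^ 2 * ‖y‖ ^ 2 : ℂ) =
      a₁ * ‖y‖ * (‖y‖ * ‖x‖ ^ 2 + ‖x‖ * 0) + a₂ * ‖x‖ * (‖y‖ * 0 + ‖x‖ * ‖y‖ ^ 2) by ring, ← this]
    refine Finset.sum_congr rfl fun i _ => ?_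
    rw [← inner_conj_symm (b i) u, Complex.mul_conj, Complex.normSq_eq_norm_sq]
    push_cast
    rfl
  have e1' := Complex.ofReal_injective e1
  have e2 : quadForm H u = ‖y‖ ^ 2 * quadForm H x + ‖x‖ ^ 2 * quadForm H y := by
    rw [hu, quadForm_add_smul hH, quadForm_smul, inner_smul_left, hxHy, Complex.norm_real,
      Complex.norm_real, norm_norm, norm_norm]
    simp
  have e3 : (∑ i, (c i : ℂ) * (inner ℂ u (b i) * inner ℂ (b i) (H u))).re =
      a₁ * ‖y‖ ^ 2 * quadForm H x + a₂ * ‖x‖ ^ 2 * quadForm H y := by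
    rw [hw, hu, map_add, map_smul, map_smul, inner_add_right, inner_add_right, inner_smul_right,
      inner_smul_right, inner_smul_right, inner_smul_right, hxHy, hyHx]
    simp only [mul_zero, add_zero, zero_add]
    rw [Complex.add_re, quadForm, quadForm,
      show (a₁ * ‖y‖ * (‖y‖ * inner ℂ x (H x)) : ℂ) =
        ((a₁ * ‖y‖ ^ 2 : ℝ) : ℂ) * inner ℂ x (H x) by push_cast; ring,
      show (a₂ * ‖x‖ * (‖x‖ * inner ℂ y (H y)) : ℂ) =
        ((a₂ * ‖x‖ ^ 2 : ℝ) : ℂ) * inner ℂ y (H y) by push_cast; ring,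
      Complex.re_ofReal_mul, Complex.re_ofReal_mul]
  have e4 : ‖u‖ ^ 2 = ‖y‖ ^ 2 * ‖x‖ ^ 2 + ‖x‖ ^ 2 * ‖y‖ ^ 2 := by
    rw [← quadForm_id, hu, quadForm_add_smul LinearMap.IsSymmetric.id, quadForm_smul,
      inner_smul_left, LinearMap.id_apply, hxy, Complex.norm_real, Complex.norm_real, norm_norm,
      norm_norm, quadForm_id, quadForm_id]
    simp
  rw [e1', e2, e3, e4] at h
  have hX : 0 < ‖x‖ ^ 2 := by positivity
  have hY : 0 < ‖y‖ ^ 2 := by positivity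
  have hfin : 0 ≤ (‖x‖ ^ 2 * ‖y‖ ^ 2 * (a₁ - a₂)) *
      (quadForm H x * ‖y‖ ^ 2 - quadForm H y * ‖x‖ ^ 2) := by
    linarith
  have hpos : 0 < ‖x‖ ^ 2 * ‖y‖ ^ 2 * (a₁ - a₂) := by
    have := sub_pos.2 ha
    positivity
  linarith [nonneg_of_mul_nonneg_right hfin hpos]

variable (b c) in
/-- The span of the basis vectors of weight at most `τ`. -/
noncomputable def lowerSpan (τ : ℝ) : Submodule ℂ E :=
  Submodule.span ℂ (Set.range fun i : {i // ¬ τ < c i} => b i)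

theorem mem_lowerSpan_iff {τ : ℝ} {x : E} :
    x ∈ lowerSpan b c τ ↔ ∀ i, τ < c i → inner ℂ (b i) x = 0 := by
  constructor
  · intro hx i hi
    have : lowerSpan b c τ ≤ (Submodule.span ℂ {b i})ᗮ := by
      rw [lowerSpan, Submodule.span_le]
      rintro _ ⟨j, rfl⟩
      rw [SetLike.mem_coe, Submodule.mem_orthogonal_singleton_iff_inner_right]
      exact b.orthonormal.2 fun h => j.2 (h ▸ hi)
    exact (Submodule.mem_orthogonal_singleton_iff_inner_right).1 (this hx)
  · intro h
    rw [← b.sum_repr' x]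
    refine Submodule.sum_mem _ fun i _ => ?_
    by_cases hi : τ < c i
    · rw [h i hi, zero_smul]; exact Submodule.zero_mem _
    · exact Submodule.smul_mem _ _ (Submodule.subset_span ⟨⟨i, hi⟩, rfl⟩)

theorem inner_eq_zero_of_mem_lowerSpan_orthogonal {τ : ℝ} {x : E} (hx : x ∈ (lowerSpan b c τ)ᗮ)
    {i : κ} (hi : ¬ τ < c i) : inner ℂ (b i) x = 0 :=
  (Submodule.mem_orthogonal _ _).1 hx _ (Submodule.subset_span ⟨⟨i, hi⟩, rfl⟩)

theorem finrank_lowerSpan (τ : ℝ) :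
    Module.finrank ℂ (lowerSpan b c τ) + {i | τ < c i}.ncard = Module.finrank ℂ E := by
  classical
  have h := finrank_span_eq_card (b.orthonormal.linearIndependent.comp
    (Subtype.val : {i // ¬ τ < c i} → κ) Subtype.val_injective)
  rw [lowerSpan, show (fun i : {i // ¬ τ < c i} => b i) = b ∘ Subtype.val from rfl, h,
    Module.finrank_eq_card_basis b.toBasis, Set.ncard_eq_toFinset_card', Set.toFinset_ofPred,
    ← Fintype.card_subtype, add_comm]
  rw [Fintype.card_subtype_compl]
  exact Nat.add_sub_of_le (Fintype.card_subtype_le _)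

theorem lowerSpan_invariant {H : E →ₗ[ℂ] E}
    (hH : ∀ i j, c i ≠ c j → inner ℂ (b i) (H (b j)) = 0) {τ : ℝ} :
    ∀ x ∈ lowerSpan b c τ, H x ∈ lowerSpan b c τ := by
  intro x hx
  rw [mem_lowerSpan_iff] at hx ⊢
  intro i hi
  rw [← b.sum_repr' x, map_sum, inner_sum]
  refine Finset.sum_eq_zero fun j _ => ?_
  rw [map_smul, inner_smul_right]
  by_cases hj : τ < c j
  · rw [hx j hj, zero_mul]
  · rw [hH i j (fun h => hj (h ▸ hi)), mul_zero]

theorem isTopSplit_lowerSpan_of_maximal {H : E →ₗ[ℂ] E} (hH : H.IsSymmetric)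
    (hmax : ∀ y' : κ → E, Orthonormal ℂ y' →
      ∑ i, c i * quadForm H (y' i) ≤ ∑ i, c i * quadForm H (b i)) (τ : ℝ) :
    IsTopSplit H (lowerSpan b c τ) := by
  have hent : ∀ i j, c i ≠ c j → inner ℂ (b i) (H (b j)) = 0 := fun i j hij =>
    inner_eq_zero_of_maximal hH b.orthonormal hmax hij
  intro x hx y hy
  rw [mem_lowerSpan_iff] at hy
  rw [quadForm_eq_sum_levelPart hent x, quadForm_eq_sum_levelPart hent y,
    norm_sq_eq_sum_levelPart (b := b) (c := c) x, norm_sq_eq_sum_levelPart (b := b) (c := c) y,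
    Finset.sum_mul_sum, Finset.sum_mul_sum, Finset.sum_comm]
  refine Finset.sum_le_sum fun a₁ _ => Finset.sum_le_sum fun a₂ _ => ?_
  have h0 : ∀ a z, (∀ i, c i = a → inner ℂ (b i) z = 0) → levelPart b c a z = 0 := by
    intro a z h
    refine Finset.sum_eq_zero fun i hi => ?_
    rw [h i (by simpa using hi), zero_smul]
  by_cases h1 : τ < a₁
  · by_cases h2 : τ < a₂
    · rw [h0 a₂ y fun i hi => hy i (hi ▸ h2)]
      simp [quadForm]
    · refine level_le_of_maximal hH hmax (a₁ := a₁) (a₂ := a₂)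
        (lt_of_le_of_lt (not_lt.1 h2) h1) ?_ ?_ <;>
      · intro i hi
        rw [inner_levelPart, if_neg hi]
  · rw [h0 a₁ x fun i hi => inner_eq_zero_of_mem_lowerSpan_orthogonal hx (hi ▸ h1)]
    simp [quadForm]

end Level

section OrthoRange

variable {E : Type*} [NormedAddCommGroup E] [InnerProductSpace ℂ E] {m : ℕ}
  {κ : Type*} [Fintype κ]

/-- The weighted sums of values of the quadratic forms of a tuple of operators along orthonormal
families; a basis-free form of the joint `C`-numerical range. -/
def orthoRange (T : Fin m → E →ₗ[ℂ] E) (c : κ → ℝ) : Set (Fin m → ℝ) :=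
  {p | ∃ y : κ → E, Orthonormal ℂ y ∧ ∀ j, p j = ∑ i, c i * quadForm (T j) (y i)}

theorem quadForm_pencil (T : Fin m → E →ₗ[ℂ] E) (θ : Fin m → ℝ) (x : E) :
    quadForm (pencil T θ) x = ∑ j, θ j * quadForm (T j) x := by
  simp [quadForm, pencil_apply, -Complex.coe_smul]

theorem dotProduct_orthoRange {T : Fin m → E →ₗ[ℂ] E} {c : κ → ℝ} {y : κ → E} {p : Fin m → ℝ}
    (hp : ∀ j, p j = ∑ i, c i * quadForm (T j) (y i)) (θ : Fin m → ℝ) :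
    θ ⬝ᵥ p = ∑ i, c i * quadForm (pencil T θ) (y i) := by
  simp only [dotProduct, hp, quadForm_pencil, Finset.mul_sum]
  rw [Finset.sum_comm]
  exact Finset.sum_congr rfl fun i _ => Finset.sum_congr rfl fun j _ => by ring

theorem exists_dotProduct_eq (f : (Fin m → ℝ) →L[ℝ] ℝ) : ∃ ν : Fin m → ℝ, ∀ p, f p = ν ⬝ᵥ p := by
  refine ⟨fun j => f (Pi.single j 1), fun p => ?_⟩
  conv_lhs => rw [pi_eq_sum_univ' p]
  simp [dotProduct, mul_comm]

theorem dotProduct_le_of_mem_convexHull {V : Set (Fin m → ℝ)} {θ : Fin m → ℝ} {u : ℝ}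
    (h : ∀ w ∈ V, θ ⬝ᵥ w ≤ u) : ∀ p ∈ convexHull ℝ V, θ ⬝ᵥ p ≤ u := by
  intro p hp
  have hc : Convex ℝ {p : Fin m → ℝ | θ ⬝ᵥ p ≤ u} :=
    convex_halfSpace_le ⟨dotProduct_add θ, fun a x => dotProduct_smul a θ x⟩ u
  exact convexHull_min h hc hp

/-- The extreme points of a polyhedral set are finite in number and generate it; each of them is
the unique maximizer of some functional. -/
theorem IsPolyhedral.extremePoints {K : Set (Fin m → ℝ)} (hK : IsPolyhedral K) :
    (K.extremePoints ℝ).Finite ∧ K = convexHull ℝ (K.extremePoints ℝ) ∧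
      ∀ w ∈ K.extremePoints ℝ, ∃ ν : Fin m → ℝ, ∀ w' ∈ K.extremePoints ℝ, w' ≠ w →
        ν ⬝ᵥ w' < ν ⬝ᵥ w := by
  obtain ⟨F, hF, rfl⟩ := hK
  set K := convexHull ℝ F with hKdef
  have hfin : (K.extremePoints ℝ).Finite := hF.subset extremePoints_convexHull_subset
  have hconv : Convex ℝ K := convex_convexHull ℝ F
  refine ⟨hfin, ?_, fun w hw => ?_⟩
  · have h := closure_convexHull_extremePoints (hF.isCompact_convexHull (𝕜 := ℝ)) hconv
    rw [(hfin.isClosed_convexHull (𝕜 := ℝ)).closure_eq] at h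
    exact h.symm
  · have hconv' : Convex ℝ (K \ {w}) := ((hconv.mem_extremePoints_iff_convex_sdiff).1 hw).2
    have hw' : w ∉ convexHull ℝ (K.extremePoints ℝ \ {w}) := fun h =>
      (convexHull_min (Set.sdiff_subset_sdiff_left extremePoints_subset) hconv' h).2 rfl
    obtain ⟨f, u, hf, hu⟩ := geometric_hahn_banach_closed_point
      (convex_convexHull ℝ (K.extremePoints ℝ \ {w})) (hfin.sdiff.isClosed_convexHull (𝕜 := ℝ)) hw'
    obtain ⟨ν, hν⟩ := exists_dotProduct_eq f
    refine ⟨ν, fun w' h1 h2 => ?_⟩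
    rw [← hν, ← hν]
    exact (hf _ (subset_convexHull ℝ _ ⟨h1, h2⟩)).trans hu

theorem exists_pos_forall_dotProduct_le {V : Set (Fin m → ℝ)} (hV : V.Finite) {ν w : Fin m → ℝ}
    (hν : ∀ w' ∈ V, w' ≠ w → ν ⬝ᵥ w' < ν ⬝ᵥ w) (μ : Fin m → ℝ) :
    ∃ ε : ℝ, 0 < ε ∧ ∀ w' ∈ V, (ν + ε • μ) ⬝ᵥ w' ≤ (ν + ε • μ) ⬝ᵥ w := by
  have h : ∀ᶠ ε : ℝ in nhdsWithin 0 (Set.Ioi 0),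
      ∀ w' ∈ V, (ν + ε • μ) ⬝ᵥ w' ≤ (ν + ε • μ) ⬝ᵥ w := by
    rw [Filter.eventually_all_finite hV]
    intro w' hw'
    by_cases hne : w' = w
    · simp [hne]
    refine Filter.Eventually.filter_mono nhdsWithin_le_nhds ?_
    simp only [add_dotProduct, smul_dotProduct, smul_eq_mul]
    have hc : ∀ v : Fin m → ℝ, Continuous fun ε : ℝ => ν ⬝ᵥ v + ε * (μ ⬝ᵥ v) := fun v => by
      fun_prop
    filter_upwards [(hc w').continuousAt.eventually_lt (hc w).continuousAt
      (by simpa using hν w' hw' hne)] with ε hε using hε.le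
  obtain ⟨ε, h1, h2⟩ := (h.and self_mem_nhdsWithin).exists
  exact ⟨ε, h2, h1⟩

variable [FiniteDimensional ℂ E]

theorem exists_orthonormalBasis_of_orthonormal {y : κ → E} (hy : Orthonormal ℂ y)
    (hcard : Fintype.card κ = Module.finrank ℂ E) : ∃ b : OrthonormalBasis κ ℂ E, ⇑b = y :=
  ⟨OrthonormalBasis.mk hy (hy.linearIndependent.span_eq_top_of_card_eq_finrank' hcard).ge,
    OrthonormalBasis.coe_mk _ _⟩

theorem exists_splitFan {T : Fin m → E →ₗ[ℂ] E} (hT : ∀ j, (T j).IsSymmetric) {c : κ → ℝ}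
    (hcard : Fintype.card κ = Module.finrank ℂ E)
    (hpoly : IsPolyhedral (convexHull ℝ (orthoRange T c))) (τ : ℝ) :
    Nonempty (SplitFan T {i | τ < c i}.ncard) := by
  obtain ⟨hfin, hK, hexp⟩ := hpoly.extremePoints
  set V := (convexHull ℝ (orthoRange T c)).extremePoints ℝ with hV
  have hVsub : V ⊆ orthoRange T c := extremePoints_convexHull_subset
  have hne : V.Nonempty := by
    rw [← convexHull_nonempty_iff (𝕜 := ℝ), ← hK, convexHull_nonempty_iff]
    let e : Fin (Module.finrank ℂ E) ≃ κ := (Fintype.equivFinOfCardEq hcard).symm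
    exact ⟨_, _, ((stdOrthonormalBasis ℂ E).reindex e).orthonormal, fun j => rfl⟩
  have hb : ∀ w : V, ∃ b : OrthonormalBasis κ ℂ E,
      ∀ j, w.1 j = ∑ i, c i * quadForm (T j) (b i) := by
    rintro ⟨w, hw⟩
    obtain ⟨y, hy, hp⟩ := hVsub hw
    obtain ⟨b, rfl⟩ := exists_orthonormalBasis_of_orthonormal hy hcard
    exact ⟨b, hp⟩
  choose b hb using hb
  have hmax : ∀ (w : V) (θ : Fin m → ℝ), (∀ w' ∈ V, θ ⬝ᵥ w' ≤ θ ⬝ᵥ w.1) →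
      ∀ y' : κ → E, Orthonormal ℂ y' →
        ∑ i, c i * quadForm (pencil T θ) (y' i) ≤ ∑ i, c i * quadForm (pencil T θ) (b w i) := by
    intro w θ hθ y' hy'
    rw [← dotProduct_orthoRange (hb w) θ, ← dotProduct_orthoRange (T := T) (c := c) (y := y')
      (p := fun j => ∑ i, c i * quadForm (T j) (y' i)) (fun j => rfl) θ]
    refine dotProduct_le_of_mem_convexHull hθ _ ?_
    rw [← hK]
    exact subset_convexHull ℝ _ ⟨y', hy', fun j => rfl⟩
  have hent : ∀ (w : V) j i i', c i ≠ c i' → inner ℂ (b w i) (T j (b w i')) = 0 := by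
    intro w j i i' hii
    obtain ⟨ν, hν⟩ := hexp w.1 w.2
    obtain ⟨ε, hε, hεN⟩ := exists_pos_forall_dotProduct_le hfin hν (Pi.single j 1)
    have hνN : ∀ w' ∈ V, ν ⬝ᵥ w' ≤ ν ⬝ᵥ w.1 := by
      intro w' hw'
      by_cases h : w' = w.1
      · rw [h]
      · exact (hν w' hw' h).le
    have h1 := inner_eq_zero_of_maximal (pencil_isSymmetric hT _) (b w).orthonormal
      (hmax w _ hνN) hii
    have h2 := inner_eq_zero_of_maximal (pencil_isSymmetric hT _) (b w).orthonormal
      (hmax w _ hεN) hii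
    rw [pencil_add, pencil_smul, pencil_single, LinearMap.add_apply, inner_add_right, h1, zero_add,
      LinearMap.smul_apply, inner_smul_right] at h2
    exact (mul_eq_zero.1 h2).resolve_left (by exact_mod_cast hε.ne')
  refine ⟨{
    ι := V
    finite := hfin.to_subtype
    N := fun w => {θ | ∀ w' ∈ V, θ ⬝ᵥ w' ≤ θ ⬝ᵥ w.1}
    L := fun w => lowerSpan (b w) c τ
    isClosed := fun w => ?_
    cover := fun θ => ?_
    rank := fun w => finrank_lowerSpan τ
    inv := fun w j => lowerSpan_invariant (hent w j)
    split := fun w θ hθ => isTopSplit_lowerSpan_of_maximal (pencil_isSymmetric hT _) (hmax w θ hθ) τ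
    fat := fun w => ?_ }⟩
  · simp only [Set.ofPred_forall]
    refine isClosed_biInter fun w' _ => isClosed_le ?_ ?_ <;> fun_prop
  · obtain ⟨w, hw, hle⟩ := hfin.exists_maximalFor (fun w => θ ⬝ᵥ w) V hne
    refine ⟨⟨w, hw⟩, fun w' hw' => ?_⟩
    rcases le_total (θ ⬝ᵥ w') (θ ⬝ᵥ w) with h | h
    · exact h
    · exact hle hw' h
  · obtain ⟨ν, hν⟩ := hexp w.1 w.2
    refine ⟨ν, fun w' hw' => ?_, fun μ => ?_⟩
    · by_cases h : w' = w.1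
      · rw [h]
      · exact (hν w' hw' h).le
    · obtain ⟨ε, hε, h⟩ := exists_pos_forall_dotProduct_le hfin hν μ
      exact ⟨ε, hε, h⟩

end OrthoRange

section CommonEigenbasis

variable {E : Type*} [NormedAddCommGroup E] [InnerProductSpace ℂ E] {m : ℕ}

theorem quadForm_pencil_eigen {T : Fin m → E →ₗ[ℂ] E} {x : E} {a : Fin m → ℝ}
    (h : ∀ j, T j x = (a j : ℂ) • x) (θ : Fin m → ℝ) : pencil T θ x = ((θ ⬝ᵥ a : ℝ) : ℂ) • x := by
  simp only [pencil_apply, h, smul_smul, ← Finset.sum_smul, dotProduct]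
  push_cast
  rfl

/-- An orthonormal basis whose first part consists of common eigenvectors, while the orthogonal
complement of this part contains no common eigenvector. -/
structure CommonEigenbasis (T : Fin m → E →ₗ[ℂ] E) (r s : ℕ) where
  basis : OrthonormalBasis (Fin r ⊕ Fin s) ℂ E
  a : Fin r → Fin m → ℝ
  eigen : ∀ i j, T j (basis (Sum.inl i)) = (a i j : ℂ) • basis (Sum.inl i)
  no_more : ∀ x, (∀ i, inner ℂ (basis (Sum.inl i)) x = 0) → ¬ IsCommonEigenvector T x

namespace CommonEigenbasis

variable {T : Fin m → E →ₗ[ℂ] E} {r s k : ℕ} (B : CommonEigenbasis T r s)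

/-- The span of the common eigenvectors. -/
noncomputable def head : Submodule ℂ E :=
  Submodule.span ℂ (Set.range fun i => B.basis (Sum.inl i))

/-- The orthogonal complement of the common eigenvectors. -/
noncomputable def tail : Submodule ℂ E := B.headᗮ

theorem mem_tail {x : E} : x ∈ B.tail ↔ ∀ i, inner ℂ (B.basis (Sum.inl i)) x = 0 := by
  constructor
  · intro h i
    exact (Submodule.mem_orthogonal _ _).1 h _ (Submodule.subset_span ⟨i, rfl⟩)
  · intro h
    have : B.head ≤ (Submodule.span ℂ {x})ᗮ := by
      rw [head, Submodule.span_le]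
      rintro _ ⟨i, rfl⟩
      rw [SetLike.mem_coe, Submodule.mem_orthogonal_singleton_iff_inner_left]
      exact h i
    rw [tail, Submodule.mem_orthogonal]
    exact fun u hu => (Submodule.mem_orthogonal_singleton_iff_inner_left).1 (this hu)

theorem pencil_inl (θ : Fin m → ℝ) (i : Fin r) :
    pencil T θ (B.basis (Sum.inl i)) = ((θ ⬝ᵥ B.a i : ℝ) : ℂ) • B.basis (Sum.inl i) :=
  quadForm_pencil_eigen (B.eigen i) θ

theorem tail_invariant (hT : ∀ j, (T j).IsSymmetric) (j : Fin m) :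
    ∀ x ∈ B.tail, T j x ∈ B.tail := by
  intro x hx
  rw [mem_tail] at hx ⊢
  intro i
  rw [← hT, B.eigen, inner_smul_left, hx i, mul_zero]

theorem no_commonEigenvector : ∀ x ∈ B.tail, ¬ IsCommonEigenvector T x :=
  fun x hx => B.no_more x (B.mem_tail.1 hx)

theorem inr_mem_tail (l : Fin s) : B.basis (Sum.inr l) ∈ B.tail := by
  rw [mem_tail]
  intro i
  exact B.basis.orthonormal.2 (by simp)

theorem finrank_head : Module.finrank ℂ B.head = r := by
  rw [head, finrank_span_eq_card (b := fun i => B.basis (Sum.inl i))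
    (B.basis.orthonormal.linearIndependent.comp _ Sum.inl_injective), Fintype.card_fin]

variable [FiniteDimensional ℂ E]

theorem finrank_tail : Module.finrank ℂ B.tail = s := by
  have h := B.head.finrank_add_finrank_orthogonal
  rw [B.finrank_head, Module.finrank_eq_card_basis B.basis.toBasis, Fintype.card_sum,
    Fintype.card_fin, Fintype.card_fin] at h
  exact Nat.add_left_cancel h

theorem le_ncard_of_eigen (hT : ∀ j, (T j).IsSymmetric) (F : SplitFan T k)
    (hk : 2 * k ≤ Module.finrank ℂ E) {θ : Fin m → ℝ} {β : ℝ} {x : E} (hx : x ∈ B.tail)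
    (hx0 : x ≠ 0) (hβ : pencil T θ x = (β : ℂ) • x) : k ≤ {i | β ≤ θ ⬝ᵥ B.a i}.ncard := by
  classical
  have hH := pencil_isSymmetric hT θ
  obtain ⟨w, hw⟩ := F.cover θ
  have hSL : B.tail ≤ F.L w :=
    F.le_of_no_commonEigenvector hT hk (B.tail_invariant hT) B.no_commonEigenvector w
  set M : Submodule ℂ E :=
    Submodule.span ℂ (Set.range fun i : {i // ¬ β ≤ θ ⬝ᵥ B.a i} => B.basis (Sum.inl i.1)) with hM
  have hML : M ≤ B.head := Submodule.span_mono (by rintro _ ⟨i, rfl⟩; exact ⟨i.1, rfl⟩)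
  have hLL : (F.L w)ᗮ ≤ B.head := by
    rw [← Submodule.orthogonal_orthogonal B.head]
    exact Submodule.orthogonal_le hSL
  have hMinv : ∀ z ∈ M, pencil T θ z ∈ M := by
    intro z hz
    refine Submodule.span_induction (p := fun z _ => pencil T θ z ∈ M) ?_ ?_ ?_ ?_ hz
    · rintro _ ⟨i, rfl⟩
      rw [B.pencil_inl]
      exact M.smul_mem _ (Submodule.subset_span ⟨i, rfl⟩)
    · simp
    · intro u v _ _ hu hv
      rw [map_add]; exact M.add_mem hu hv
    · intro t u _ hu
      rw [map_smul]; exact M.smul_mem _ hu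
  have hdisj : M ⊓ (F.L w)ᗮ = ⊥ := by
    by_contra hne
    obtain ⟨γ, z, ⟨hzM, hzL⟩, hz0, hγ⟩ := exists_real_eigenvector hH (S := M ⊓ (F.L w)ᗮ)
      (fun z hz => ⟨hMinv z hz.1, mem_orthogonal_of_symmetric hH
        (pencil_mem (F.inv w) θ) hz.2⟩) hne
    have hβγ : β ≤ γ := by
      have h := F.split w θ hw z hzL x (hSL hx)
      rw [quadForm_of_eigen hβ, quadForm_of_eigen hγ] at h
      have h1 : 0 < ‖x‖ ^ 2 := by positivity
      have h2 : 0 < ‖z‖ ^ 2 := by positivity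
      have h3 : β * (‖x‖ ^ 2 * ‖z‖ ^ 2) ≤ γ * (‖x‖ ^ 2 * ‖z‖ ^ 2) := by linarith
      exact le_of_mul_le_mul_right h3 (by positivity)
    have hzorth : z ∈ Mᗮ := by
      have : M ≤ (Submodule.span ℂ {z})ᗮ := by
        rw [hM, Submodule.span_le]
        rintro _ ⟨i, rfl⟩
        rw [SetLike.mem_coe, Submodule.mem_orthogonal_singleton_iff_inner_left]
        have h := hH (B.basis (Sum.inl i.1)) z
        rw [B.pencil_inl, hγ, inner_smul_left, inner_smul_right, Complex.conj_ofReal] at h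
        have hne : ((θ ⬝ᵥ B.a i.1 : ℝ) : ℂ) - γ ≠ 0 := by
          rw [← Complex.ofReal_sub, Complex.ofReal_ne_zero]
          have := i.2
          intro h0
          linarith
        exact (mul_eq_zero.1 (by rw [sub_mul, h, sub_self])).resolve_left hne
      rw [Submodule.mem_orthogonal]
      exact fun u hu => (Submodule.mem_orthogonal_singleton_iff_inner_left).1 (this hu)
    exact hz0 ((Submodule.mem_bot ℂ).1 (M.inf_orthogonal_eq_bot ▸ ⟨hzM, hzorth⟩))
  have hsum := Submodule.finrank_sup_add_finrank_inf_eq M (F.L w)ᗮ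
  rw [hdisj, finrank_bot, add_zero] at hsum
  have hle := Submodule.finrank_mono (sup_le hML hLL)
  rw [hsum, B.finrank_head] at hle
  have hMr : Module.finrank ℂ M = Fintype.card {i // ¬ β ≤ θ ⬝ᵥ B.a i} := by
    rw [hM, finrank_span_eq_card
      (b := fun i : {i // ¬ β ≤ θ ⬝ᵥ B.a i} => B.basis (Sum.inl i.1))
      (B.basis.orthonormal.linearIndependent.comp _
        (Sum.inl_injective.comp Subtype.val_injective))]
  have hLr := (F.L w).finrank_add_finrank_orthogonal
  have hrk := F.rank w
  rw [hMr, Fintype.card_subtype_compl, Fintype.card_fin] at hle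
  have hc : Fintype.card {i // β ≤ θ ⬝ᵥ B.a i} ≤ r := by
    simpa using Fintype.card_subtype_le fun i => β ≤ θ ⬝ᵥ B.a i
  rw [Set.ncard_eq_toFinset_card', Set.toFinset_ofPred, ← Fintype.card_subtype]
  omega

theorem le_ncard_of_eigen' (hT : ∀ j, (T j).IsSymmetric) (F : SplitFan T k)
    (hk : 2 * k ≤ Module.finrank ℂ E) {θ : Fin m → ℝ} {β : ℝ} {x : E} (hx : x ∈ B.tail)
    (hx0 : x ≠ 0) (hβ : pencil T θ x = (β : ℂ) • x) : k ≤ {i | θ ⬝ᵥ B.a i ≤ β}.ncard := by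
  have h := B.le_ncard_of_eigen hT F hk (θ := -θ) (β := -β) hx hx0 (by
    rw [pencil_neg, LinearMap.neg_apply, hβ, Complex.ofReal_neg, neg_smul])
  simpa only [neg_dotProduct, neg_le_neg_iff] using h

theorem two_mul_le (B : CommonEigenbasis T r s) (hT : ∀ j, (T j).IsSymmetric) (F : SplitFan T k)
    (hk : 2 * k ≤ Module.finrank ℂ E) : 2 * k ≤ r := by
  by_cases hS : B.tail = ⊥
  · have h := B.finrank_tail
    rw [hS, finrank_bot] at h
    rw [Module.finrank_eq_card_basis B.basis.toBasis, Fintype.card_sum, Fintype.card_fin,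
      Fintype.card_fin, ← h] at hk
    exact hk
  by_contra hlt
  have huniq : ∀ μ, ∃ β : ℝ, ∀ x ∈ B.tail, pencil T μ x = (β : ℂ) • x := by
    intro μ
    refine scalar_on_of_unique_eigenvalue (pencil_isSymmetric hT μ)
      (pencil_mem (B.tail_invariant hT) μ) ?_
    intro β₁ β₂ x₁ x₂ h₁ h₂ hx₁ hx₂ he₁ he₂ hβ
    apply hlt
    have c₁ := B.le_ncard_of_eigen' hT F hk h₁ hx₁ he₁
    have c₂ := B.le_ncard_of_eigen hT F hk h₂ hx₂ he₂
    have hd : Disjoint {i | μ ⬝ᵥ B.a i ≤ β₁} {i | β₂ ≤ μ ⬝ᵥ B.a i} := by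
      rw [Set.disjoint_left]
      intro i hi₁ hi₂
      exact not_le.2 hβ (le_trans (Set.mem_ofPred.1 hi₂) (Set.mem_ofPred.1 hi₁))
    have hu := Set.ncard_union_eq hd
    have hle := Set.ncard_le_card ({i | μ ⬝ᵥ B.a i ≤ β₁} ∪ {i | β₂ ≤ μ ⬝ᵥ B.a i})
    rw [Nat.card_fin] at hle
    omega
  obtain ⟨x, hx, hx0⟩ := Submodule.exists_mem_ne_zero_of_ne_bot hS
  refine B.no_commonEigenvector x hx (isCommonEigenvector_of_pencil hx0 fun μ => ?_)
  obtain ⟨β, hβ⟩ := huniq μ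
  exact ⟨β, hβ x hx⟩

end CommonEigenbasis

theorem IsCommonEigenvector.smul {T : Fin m → E →ₗ[ℂ] E} {x : E} (h : IsCommonEigenvector T x)
    {t : ℂ} (ht : t ≠ 0) : IsCommonEigenvector T (t • x) := by
  obtain ⟨hx, a, ha⟩ := h
  exact ⟨smul_ne_zero ht hx, a, fun j => by rw [map_smul, ha, smul_comm]⟩

variable [FiniteDimensional ℂ E]

theorem exists_commonEigenbasis (T : Fin m → E →ₗ[ℂ] E) :
    ∃ r s, Nonempty (CommonEigenbasis T r s) := by
  classical
  let P : ℕ → Prop := fun r =>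
    ∃ v : Fin r → E, Orthonormal ℂ v ∧ ∀ i, IsCommonEigenvector T (v i)
  have hP0 : P 0 := ⟨Fin.elim0, ⟨fun i => i.elim0, fun i => i.elim0⟩, fun i => i.elim0⟩
  have hPle : ∀ r, P r → r ≤ Module.finrank ℂ E := by
    rintro r ⟨v, hv, -⟩
    simpa using hv.linearIndependent.fintype_card_le_finrank
  obtain ⟨r, ⟨v, hv, hvT⟩, hmax⟩ : ∃ r, P r ∧ ¬ P (r + 1) :=
    ⟨_, Nat.findGreatest_spec (Nat.zero_le (Module.finrank ℂ E)) hP0, fun h =>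
      absurd (Nat.le_findGreatest (hPle _ h) h) (by omega)⟩
  choose hv0 a ha using hvT
  set S : Submodule ℂ E := (Submodule.span ℂ (Set.range v))ᗮ with hS
  have hvS : ∀ i, ∀ x ∈ S, inner ℂ (v i) x = 0 := fun i x hx =>
    (Submodule.mem_orthogonal _ _).1 hx _ (Submodule.subset_span ⟨i, rfl⟩)
  have hSv : ∀ x, (∀ i, inner ℂ (v i) x = 0) → ¬ IsCommonEigenvector T x := by
    intro x hx hxT
    apply hmax
    have hn : ‖x‖ ≠ 0 := norm_ne_zero_iff.2 hxT.1
    refine ⟨Fin.cons (((‖x‖⁻¹ : ℝ) : ℂ) • x) v, ?_, ?_⟩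
    · rw [orthonormal_iff_ite] at hv ⊢
      have hx' : ∀ i, inner ℂ x (v i) = 0 := fun i => by rw [← inner_conj_symm, hx i, map_zero]
      intro i j
      refine Fin.cases ?_ (fun i => ?_) i <;> refine Fin.cases ?_ (fun j => ?_) j
      · rw [Fin.cons_zero, inner_smul_left, inner_smul_right, inner_self_eq_norm_sq_to_K,
          Complex.conj_ofReal]
        simp only [if_true]
        have hc : (‖x‖ : ℂ) ≠ 0 := by exact_mod_cast hn
        change ((‖x‖⁻¹ : ℝ) : ℂ) * (((‖x‖⁻¹ : ℝ) : ℂ) * (‖x‖ : ℂ) ^ 2) = 1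
        rw [Complex.ofReal_inv]
        field_simp
      · simp [inner_smul_left, hx', -Complex.coe_smul, (Fin.succ_ne_zero j).symm]
      · simp [inner_smul_right, hx, -Complex.coe_smul, Fin.succ_ne_zero i]
      · simp [hv]
    · intro i
      refine Fin.cases ?_ (fun i => ?_) i
      · rw [Fin.cons_zero]
        exact hxT.smul (by exact_mod_cast inv_ne_zero hn)
      · rw [Fin.cons_succ]
        exact ⟨hv0 i, a i, ha i⟩
  let f := stdOrthonormalBasis ℂ S
  have hon : Orthonormal ℂ (Sum.elim v fun l => (f l : E)) := by
    have hf := f.orthonormal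
    rw [orthonormal_iff_ite] at hf hv ⊢
    rintro (i | i) (j | j)
    · simp [hv]
    · simp [hvS i _ (f j).2]
    · rw [Sum.elim_inl, Sum.elim_inr, ← inner_conj_symm, hvS j _ (f i).2]
      simp
    · simpa using hf i j
  have hcard : Fintype.card (Fin r ⊕ Fin (Module.finrank ℂ S)) = Module.finrank ℂ E := by
    rw [Fintype.card_sum, Fintype.card_fin, Fintype.card_fin,
      ← (Submodule.span ℂ (Set.range v)).finrank_add_finrank_orthogonal,
      finrank_span_eq_card hv.linearIndependent, Fintype.card_fin]
  obtain ⟨b, hb⟩ := exists_orthonormalBasis_of_orthonormal hon hcard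
  exact ⟨r, _, ⟨⟨b, a, fun i j => by rw [hb]; exact ha i j, fun x hx => hSv x fun i => by
    simpa [hb] using hx i⟩⟩⟩

end CommonEigenbasis

section TraceInequality

variable {E : Type*} [NormedAddCommGroup E] [InnerProductSpace ℂ E] {κ : Type*} [Fintype κ]

theorem quadForm_eq_sum_of_eigenbasis {H : E →ₗ[ℂ] E} (f : OrthonormalBasis κ ℂ E) {h : κ → ℝ}
    (hf : ∀ l, H (f l) = (h l : ℂ) • f l) (x : E) :
    quadForm H x = ∑ l, ‖inner ℂ (f l) x‖ ^ 2 * h l := by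
  have hx : H x = ∑ l, (inner ℂ (f l) x * h l) • f l := by
    conv_lhs => rw [← f.sum_repr' x]
    simp only [map_sum, map_smul, hf, smul_smul]
  rw [quadForm, hx, inner_sum, Complex.re_sum]
  refine Finset.sum_congr rfl fun l _ => ?_
  rw [inner_smul_right, ← inner_conj_symm x (f l), mul_right_comm, Complex.mul_conj,
    Complex.normSq_eq_norm_sq, ← Complex.ofReal_mul, Complex.ofReal_re]

/-- Von Neumann's trace inequality, for a symmetric operator with a given eigenbasis. -/
theorem sum_quadForm_le_of_monovary {H : E →ₗ[ℂ] E} (f y : OrthonormalBasis κ ℂ E) {c h : κ → ℝ}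
    (hf : ∀ l, H (f l) = (h l : ℂ) • f l) (hch : Monovary c h) :
    ∑ i, c i * quadForm H (y i) ≤ ∑ i, c i * h i := by
  classical
  set P : Matrix κ κ ℝ := Matrix.of fun i l => ‖inner ℂ (f l) (y i)‖ ^ 2 with hP
  have hPd : P ∈ doublyStochastic ℝ κ := by
    rw [mem_doublyStochastic_iff_sum]
    refine ⟨fun i l => by rw [hP, Matrix.of_apply]; positivity, fun i => ?_, fun l => ?_⟩
    · simp [hP, f.sum_sq_norm_inner_right, y.orthonormal.1 i]
    · simp [hP, y.sum_sq_norm_inner_left, f.orthonormal.1 l]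
  have hsum : ∑ i, c i * quadForm H (y i) = c ⬝ᵥ (P *ᵥ h) := by
    simp only [quadForm_eq_sum_of_eigenbasis f hf, dotProduct, mulVec, hP, Matrix.of_apply]
  have hconv : Convex ℝ {Q : Matrix κ κ ℝ | c ⬝ᵥ (Q *ᵥ h) ≤ ∑ i, c i * h i} := by
    refine convex_halfSpace_le (f := fun Q : Matrix κ κ ℝ => c ⬝ᵥ (Q *ᵥ h)) ⟨?_, ?_⟩ _
    · intro Q R
      rw [add_mulVec, dotProduct_add]
    · intro a Q
      rw [smul_mulVec, dotProduct_smul]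
  rw [hsum]
  have hmem : P ∈ (doublyStochastic ℝ κ : Set (Matrix κ κ ℝ)) := hPd
  rw [doublyStochastic_eq_convexHull_permMatrix] at hmem
  refine convexHull_min ?_ hconv hmem
  rintro _ ⟨σ, rfl⟩
  rw [Set.mem_ofPred, permMatrix_mulVec]
  exact hch.sum_mul_comp_perm_le_sum_mul

end TraceInequality

section Transfer

variable {r : ℕ}

/-- A set of tuples is closed under transfers if it is closed under moving two entries towards each
other while keeping their sum. -/
def IsTransferClosed (S : Set (Fin r → ℝ)) : Prop :=
  ∀ x ∈ S, ∀ j k, j ≠ k → ∀ s, 0 ≤ s → s ≤ x j - x k →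
    (fun i => if i = j then x j - s else if i = k then x k + s else x i) ∈ S

theorem IsTransferClosed.comp_perm {S : Set (Fin r → ℝ)} (hS : IsTransferClosed S)
    (σ : Equiv.Perm (Fin r)) : IsTransferClosed {x | x ∘ σ ∈ S} := by
  intro x hx j k hjk s hs hs'
  have h := hS _ hx (σ.symm j) (σ.symm k) (by simpa using hjk) s hs (by simpa using hs')
  have e : (fun i => if i = j then x j - s else if i = k then x k + s else x i) ∘ σ =
      fun i => if i = σ.symm j then (x ∘ σ) (σ.symm j) - s else
        if i = σ.symm k then (x ∘ σ) (σ.symm k) + s else (x ∘ σ) i := by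
    funext i
    simp [Equiv.eq_symm_apply]
  rw [Set.mem_ofPred, e]
  exact h

theorem IsTransferClosed.mem_of_partialSums {S : Set (Fin r → ℝ)} (hS : IsTransferClosed S)
    {d : Fin r → ℝ} (hd : Antitone d) {x : Fin r → ℝ} (hx : x ∈ S)
    (hle : ∀ p, ∑ i with i ≤ p, d i ≤ ∑ i with i ≤ p, x i) (heq : ∑ i, d i = ∑ i, x i) :
    d ∈ S := by
  classical
  induction hN : (Finset.univ.filter fun i => x i ≠ d i).card using Nat.strong_induction_on
    generalizing x with
  | _ N ih =>
    by_cases hneg : ∃ k, x k < d k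
    · obtain ⟨k, hk, hkmin⟩ : ∃ k, x k < d k ∧ ∀ i, i < k → d i ≤ x i := by
        obtain ⟨k, hk⟩ := (Set.toFinite {k | x k < d k}).exists_minimal hneg
        exact ⟨k, hk.1, fun i hi => not_lt.1 fun h => hk.not_lt (y := i) h hi⟩
      obtain ⟨j, hjk, hj⟩ : ∃ j, j < k ∧ d j < x j := by
        by_contra! hall
        refine absurd (hle k) (not_le.2 ?_)
        refine Finset.sum_lt_sum (fun i hi => ?_) ⟨k, by simp, hk⟩
        rcases (Finset.mem_filter.1 hi).2.lt_or_eq with h | h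
        · exact hall i h
        · rw [h]; exact hk.le
      set δ := min (x j - d j) (d k - x k) with hδ
      have hδ0 : 0 < δ := lt_min (by linarith) (by linarith)
      have hδj : δ ≤ x j - d j := min_le_left _ _
      have hδk : δ ≤ d k - x k := min_le_right _ _
      have hdkj : d k ≤ d j := hd hjk.le
      set x' : Fin r → ℝ := fun i => if i = j then x j - δ else if i = k then x k + δ else x i
        with hx'
      have hx'S : x' ∈ S := hS x hx j k hjk.ne δ hδ0.le (by linarith)
      have hx'e : ∀ i, x' i = x i - (if i = j then δ else 0) + (if i = k then δ else 0) := by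
        intro i
        simp only [hx']
        by_cases h1 : i = j
        · have h2 : i ≠ k := fun h => hjk.ne (h1.symm.trans h)
          simp [h1, hjk.ne]
        · by_cases h2 : i = k
          · simp [h2, hjk.ne']
          · simp [h1, h2]
      refine ih _ ?_ hx'S ?_ ?_ rfl
      · rw [← hN]
        refine Finset.card_lt_card ?_
        rw [Finset.ssubset_iff_of_subset]
        · rcases min_choice (x j - d j) (d k - x k) with h | h
          · refine ⟨j, by simpa using hj.ne', ?_⟩
            simp [hx', hδ, h]
          · refine ⟨k, by simpa using hk.ne, ?_⟩
            simp [hx', hδ, h, hjk.ne']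
        · intro i hi
          simp only [Finset.mem_filter, Finset.mem_univ, true_and] at hi ⊢
          rcases eq_or_ne i j with rfl | h1
          · exact hj.ne'
          rcases eq_or_ne i k with rfl | h2
          · exact hk.ne
          simpa [hx', h1, h2] using hi
      · intro p
        simp only [hx'e, Finset.sum_add_distrib, Finset.sum_sub_distrib]
        rw [Finset.sum_ite_eq', Finset.sum_ite_eq']
        simp only [Finset.mem_filter, Finset.mem_univ, true_and]
        by_cases hkp : k ≤ p
        · simpa [hkp, hjk.le.trans hkp] using hle p
        · by_cases hjp : j ≤ p
          · rw [if_pos hjp, if_neg hkp, add_zero, le_sub_iff_add_le', ← le_sub_iff_add_le,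
              ← Finset.sum_sub_distrib]
            refine hδj.trans (Finset.single_le_sum (f := fun i => x i - d i) (fun i hi => ?_)
              (Finset.mem_filter.2 ⟨Finset.mem_univ j, hjp⟩))
            have hip := (Finset.mem_filter.1 hi).2
            exact sub_nonneg.2 (hkmin i (lt_of_le_of_lt hip (not_le.1 hkp)))
          · simpa [hkp, hjp] using hle p
      · simp only [hx'e, Finset.sum_add_distrib, Finset.sum_sub_distrib]
        simpa using heq
    · have hall : ∀ i, d i ≤ x i := fun i => not_lt.1 fun h => hneg ⟨i, h⟩
      have := (Finset.sum_eq_sum_iff_of_le fun i _ => hall i).1 heq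
      rwa [show d = x from funext fun i => this i (Finset.mem_univ i)]

/-- A set of tuples closed under transfers contains the permutohedron of a tuple all of whose
permutations it contains. -/
theorem IsTransferClosed.convexHull_subset {S : Set (Fin r → ℝ)} (hS : IsTransferClosed S)
    {c : Fin r → ℝ} (hc : ∀ σ : Equiv.Perm (Fin r), c ∘ σ ∈ S) :
    convexHull ℝ (Set.range fun σ : Equiv.Perm (Fin r) => c ∘ σ) ⊆ S := by
  intro d hd
  have hsort : ∀ v : Fin r → ℝ, ∃ σ : Equiv.Perm (Fin r), Antitone (v ∘ σ) := fun v =>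
    ⟨Tuple.sort (-v), fun i j hij => neg_le_neg_iff.1 (Tuple.monotone_sort (-v) hij)⟩
  obtain ⟨σ, hσ⟩ := hsort d
  obtain ⟨τ, hτ⟩ := hsort c
  have hbound : ∀ (w : Fin r → ℝ) (u : ℝ),
      (∀ π : Equiv.Perm (Fin r), w ⬝ᵥ (c ∘ π) ≤ u) → w ⬝ᵥ d ≤ u := by
    intro w u h
    refine dotProduct_le_of_mem_convexHull ?_ d hd
    rintro _ ⟨π, rfl⟩
    exact h π
  have hmem : d ∘ σ ∈ {x | x ∘ σ.symm ∈ S} := by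
    refine (hS.comp_perm σ.symm).mem_of_partialSums hσ (x := c ∘ τ) ?_ (fun p => ?_) ?_
    · exact hc (τ * σ.symm)
    · have h := hbound (fun i => if σ.symm i ≤ p then 1 else 0) (∑ i with i ≤ p, (c ∘ τ) i) ?_
      · rw [dotProduct, ← Equiv.sum_comp σ] at h
        simpa [Finset.sum_filter] using h
      · intro π
        have hm : Monovary (fun i : Fin r => if i ≤ p then (1 : ℝ) else 0) (c ∘ τ) := by
          refine Antitone.monovary ?_ hτ
          intro i j hij
          dsimp only
          split_ifs with h1 h2
          · exact le_rfl
          · exact absurd (hij.trans h1) h2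
          · exact zero_le_one
          · exact le_rfl
        have h := hm.sum_mul_comp_perm_le_sum_mul (σ := τ.symm * π * σ)
        rw [dotProduct, ← Equiv.sum_comp σ]
        simpa [Finset.sum_filter] using h
    · have h1 := hbound 1 (∑ i, c i) fun π => by
        rw [one_dotProduct]; exact (Equiv.sum_comp π c).le
      have h2 := hbound (-1) (-∑ i, c i) fun π => by
        rw [neg_dotProduct, one_dotProduct]; exact (neg_le_neg (Equiv.sum_comp π c).ge)
      rw [neg_dotProduct, one_dotProduct] at h2
      rw [one_dotProduct] at h1
      have e1 : ∑ i, (d ∘ σ) i = ∑ i, d i := Equiv.sum_comp σ d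
      have e2 : ∑ i, (c ∘ τ) i = ∑ i, c i := Equiv.sum_comp τ c
      rw [e1, e2]
      linarith
  simpa [Function.comp_assoc] using hmem

end Transfer

section Horn

variable {E : Type*} [NormedAddCommGroup E] [InnerProductSpace ℂ E] {r : ℕ}

/-- The diagonals, with respect to the orthonormal family `b`, of the operators on its span that
have eigenvalues `c`. -/
def diagonals (b : Fin r → E) (c : Fin r → ℝ) : Set (Fin r → ℝ) :=
  {x | ∃ y : Fin r → E, Orthonormal ℂ y ∧ (∀ l, y l ∈ Submodule.span ℂ (Set.range b)) ∧
    ∀ i, x i = ∑ l, c l * ‖inner ℂ (b i) (y l)‖ ^ 2}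

theorem comp_perm_mem_diagonals {b : Fin r → E} (hb : Orthonormal ℂ b) (c : Fin r → ℝ)
    (σ : Equiv.Perm (Fin r)) : c ∘ σ ∈ diagonals b c := by
  classical
  refine ⟨b ∘ σ.symm, hb.comp _ σ.symm.injective, fun l => Submodule.subset_span ⟨_, rfl⟩,
    fun i => ?_⟩
  rw [Finset.sum_eq_single (σ i)]
  · simp [hb.1 i]
  · intro l _ hl
    rw [Function.comp_apply, hb.2 fun h => hl (by rw [h, Equiv.apply_symm_apply])]
    simp
  · simp

theorem exists_phase (w : ℂ) : ∃ ω : ℂ, ‖ω‖ = 1 ∧ (starRingEnd ℂ ω * w).re = 0 := by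
  rcases eq_or_ne w 0 with rfl | hw
  · exact ⟨1, by simp, by simp⟩
  have hn : (‖w‖ : ℂ) ≠ 0 := by exact_mod_cast norm_ne_zero_iff.2 hw
  refine ⟨Complex.I * w / ‖w‖, ?_, ?_⟩
  · rw [norm_div, norm_mul, Complex.norm_I, one_mul, Complex.norm_real, norm_norm,
      div_self (norm_ne_zero_iff.2 hw)]
  · rw [map_div₀, map_mul, Complex.conj_I, Complex.conj_ofReal,
      show -Complex.I * starRingEnd ℂ w / ‖w‖ * w = -Complex.I * (w * starRingEnd ℂ w) / ‖w‖ by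
        ring, Complex.mul_conj', mul_div_assoc, sq, mul_div_cancel_left₀ _ hn]
    simp

theorem norm_sq_real_combination (a b : ℝ) (p q : ℂ) :
    ‖a * p + b * q‖ ^ 2 =
      a ^ 2 * ‖p‖ ^ 2 + b ^ 2 * ‖q‖ ^ 2 + 2 * a * b * (starRingEnd ℂ p * q).re := by
  rw [← Complex.normSq_eq_norm_sq, ← Complex.normSq_eq_norm_sq, ← Complex.normSq_eq_norm_sq,
    Complex.normSq_apply, Complex.normSq_apply, Complex.normSq_apply, Complex.mul_re]
  simp
  ring

theorem norm_sq_reflect {α β : ℝ} (h : α ^ 2 + β ^ 2 = 1) {ω : ℂ} (hω : ‖ω‖ = 1) (p q : ℂ) :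
    ‖p + -2 * (α * p + β * starRingEnd ℂ ω * q) * α‖ ^ 2 =
        ‖p‖ ^ 2 - 4 * α ^ 2 * β ^ 2 * (‖p‖ ^ 2 - ‖q‖ ^ 2) -
          4 * α * β * (1 - 2 * α ^ 2) * (starRingEnd ℂ ω * (starRingEnd ℂ p * q)).re ∧
      ‖q + -2 * (α * p + β * starRingEnd ℂ ω * q) * (β * ω)‖ ^ 2 =
        ‖q‖ ^ 2 + 4 * α ^ 2 * β ^ 2 * (‖p‖ ^ 2 - ‖q‖ ^ 2) +
          4 * α * β * (1 - 2 * α ^ 2) * (starRingEnd ℂ ω * (starRingEnd ℂ p * q)).re := by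
  have hωω : starRingEnd ℂ ω * ω = 1 := by rw [Complex.conj_mul', hω]; simp
  have hω' : ‖starRingEnd ℂ ω‖ = 1 := by rw [RCLike.norm_conj, hω]
  have e1 := norm_sq_real_combination (1 - 2 * α ^ 2) (-2 * α * β) p (starRingEnd ℂ ω * q)
  have e2 := norm_sq_real_combination (-2 * α * β) (1 - 2 * β ^ 2) p (starRingEnd ℂ ω * q)
  rw [norm_mul, hω', one_mul, mul_left_comm (starRingEnd ℂ p)] at e1 e2
  constructor
  · rw [show p + -2 * (α * p + β * starRingEnd ℂ ω * q) * α =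
      ((1 - 2 * α ^ 2 : ℝ) : ℂ) * p + ((-2 * α * β : ℝ) : ℂ) * (starRingEnd ℂ ω * q) by
        push_cast; ring, e1]
    linear_combination 4 * α ^ 2 * ‖p‖ ^ 2 * h
  · have hrot : ∀ w : ℂ, ‖w‖ = ‖starRingEnd ℂ ω * w‖ := fun w => by rw [norm_mul, hω', one_mul]
    rw [hrot (q + _),
      show starRingEnd ℂ ω * (q + -2 * (α * p + β * starRingEnd ℂ ω * q) * (β * ω)) =
        ((-2 * α * β : ℝ) : ℂ) * p + ((1 - 2 * β ^ 2 : ℝ) : ℂ) * (starRingEnd ℂ ω * q) by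
          push_cast
          linear_combination -2 * β * (α * p + β * starRingEnd ℂ ω * q) * hωω, e2]
    linear_combination (4 * β ^ 2 * ‖q‖ ^ 2 +
      8 * α * β * (starRingEnd ℂ ω * (starRingEnd ℂ p * q)).re) * h

theorem isTransferClosed_diagonals {b : Fin r → E} (hb : Orthonormal ℂ b) (c : Fin r → ℝ) :
    IsTransferClosed (diagonals b c) := by
  classical
  rintro x ⟨y, hy, hyb, hx⟩ j k hjk s hs hs'
  rcases eq_or_lt_of_le (hs.trans hs') with h0 | hpos
  · have hs0 : s = 0 := by linarith
    refine ⟨y, hy, hyb, fun i => ?_⟩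
    rw [← hx, hs0]
    dsimp only
    split_ifs with h1 h2
    · rw [h1, sub_zero]
    · rw [h2, add_zero]
    · rfl
  obtain ⟨σ, hσ0, hσ1, hσ⟩ : ∃ σ : ℝ, 0 ≤ σ ∧ σ ≤ 1 ∧ s = σ * (x j - x k) :=
    ⟨s / (x j - x k), div_nonneg hs hpos.le, (div_le_one hpos).2 hs',
      (div_mul_cancel₀ _ hpos.ne').symm⟩
  obtain ⟨α, β, hαβ, hσαβ⟩ : ∃ α β : ℝ, α ^ 2 + β ^ 2 = 1 ∧ 4 * α ^ 2 * β ^ 2 = σ := by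
    have h1 : Real.sqrt (1 - σ) ≤ 1 := Real.sqrt_le_one.2 (by linarith)
    have h2 : Real.sqrt (1 - σ) ^ 2 = 1 - σ := Real.sq_sqrt (by linarith)
    have h3 := Real.sqrt_nonneg (1 - σ)
    refine ⟨Real.sqrt ((1 - Real.sqrt (1 - σ)) / 2), Real.sqrt ((1 + Real.sqrt (1 - σ)) / 2),
      ?_, ?_⟩ <;> rw [Real.sq_sqrt (by linarith), Real.sq_sqrt (by linarith)]
    · ring
    · linear_combination -h2
  obtain ⟨ω, hω, hω'⟩ := exists_phase
    (∑ l, c l * (starRingEnd ℂ (inner ℂ (b j) (y l)) * inner ℂ (b k) (y l)))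
  have hαβ' : (α : ℂ) ^ 2 + (β : ℂ) ^ 2 = 1 := by exact_mod_cast hαβ
  have hωω : ω * starRingEnd ℂ ω = 1 := by rw [Complex.mul_conj', hω]; simp
  have hbi := orthonormal_iff_ite.1 hb
  set u : E := (α : ℂ) • b j + (β * ω : ℂ) • b k with hu
  have hu1 : ‖u‖ = 1 := by
    have h : inner ℂ u u = (1 : ℂ) := by
      rw [hu]
      simp only [inner_add_left, inner_add_right, inner_smul_left, inner_smul_right, hbi, hjk,
        hjk.symm, if_true, if_false, map_mul, Complex.conj_ofReal]
      linear_combination hαβ' + (β : ℂ) ^ 2 * hωω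
    rw [inner_self_eq_norm_sq_to_K, RCLike.ofReal_eq_complex_ofReal, ← Complex.ofReal_pow,
      Complex.ofReal_eq_one] at h
    exact (pow_eq_one_iff_of_nonneg (norm_nonneg u) two_ne_zero).1 h
  refine ⟨fun l => y l + (-2 * inner ℂ u (y l)) • u, orthonormal_reflect hy hu1 ?_,
    fun l => ?_, fun i => ?_⟩
  · rw [map_neg, map_ofNat]
    norm_num
  · refine Submodule.add_mem _ (hyb l) (Submodule.smul_mem _ _ ?_)
    exact Submodule.add_mem _ (Submodule.smul_mem _ _ (Submodule.subset_span ⟨j, rfl⟩))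
      (Submodule.smul_mem _ _ (Submodule.subset_span ⟨k, rfl⟩))
  have huy : ∀ l, inner ℂ u (y l) =
      α * inner ℂ (b j) (y l) + β * starRingEnd ℂ ω * inner ℂ (b k) (y l) := by
    intro l
    rw [hu, inner_add_left, inner_smul_left, inner_smul_left, map_mul, Complex.conj_ofReal,
      Complex.conj_ofReal]
  have hbu : inner ℂ (b i) u = (if i = j then (α : ℂ) else 0) + if i = k then β * ω else 0 := by
    rw [hu, inner_add_right, inner_smul_right, inner_smul_right, hbi, hbi]
    simp
  have hmix : ∑ l, c l * (starRingEnd ℂ ω * (starRingEnd ℂ (inner ℂ (b j) (y l)) *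
      inner ℂ (b k) (y l))).re = 0 := by
    rw [← hω', Finset.mul_sum, Complex.re_sum]
    refine Finset.sum_congr rfl fun l _ => ?_
    rw [mul_left_comm (starRingEnd ℂ ω) (c l : ℂ), Complex.re_ofReal_mul]
  have hsum : ∑ l, c l * (‖inner ℂ (b j) (y l)‖ ^ 2 - ‖inner ℂ (b k) (y l)‖ ^ 2) = x j - x k := by
    simp only [mul_sub, Finset.sum_sub_distrib, ← hx]
  simp only [inner_add_right, inner_smul_right, hbu, huy]
  by_cases h1 : i = j
  · simp only [h1, if_true, if_neg hjk, add_zero, (norm_sq_reflect hαβ hω _ _).1, hσαβ]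
    rw [hσ, ← hsum, hx j, ← sub_zero (_ - _), ← mul_zero (4 * α * β * (1 - 2 * α ^ 2)), ← hmix,
      Finset.mul_sum, Finset.mul_sum, ← Finset.sum_sub_distrib, ← Finset.sum_sub_distrib]
    exact Finset.sum_congr rfl fun l _ => by ring
  · by_cases h2 : i = k
    · simp only [h2, if_true, if_neg hjk.symm, zero_add, (norm_sq_reflect hαβ hω _ _).2, hσαβ]
      rw [hσ, ← hsum, hx k, ← add_zero (_ + _), ← mul_zero (4 * α * β * (1 - 2 * α ^ 2)), ← hmix,
        Finset.mul_sum, Finset.mul_sum, ← Finset.sum_add_distrib, ← Finset.sum_add_distrib]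
      exact Finset.sum_congr rfl fun l _ => by ring
    · simp [h1, h2, hx i]

/-- The Schur-Horn theorem, in the direction due to Horn. -/
theorem convexHull_perm_subset_diagonals {b : Fin r → E} (hb : Orthonormal ℂ b) (c : Fin r → ℝ) :
    convexHull ℝ (Set.range fun σ : Equiv.Perm (Fin r) => c ∘ σ) ⊆ diagonals b c :=
  (isTransferClosed_diagonals hb c).convexHull_subset (comp_perm_mem_diagonals hb c)

end Horn

section Conclusion

theorem exists_perm_monovary {r : ℕ} (c g : Fin r → ℝ) :
    ∃ σ : Equiv.Perm (Fin r), Monovary (c ∘ σ) g := by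
  refine ⟨(Tuple.sort g).symm.trans (Tuple.sort c), ?_⟩
  have h := ((Tuple.monotone_sort c).monovary (Tuple.monotone_sort g)).comp_right
    (Tuple.sort g).symm
  intro i j hij
  simpa using @h i j (by simpa using hij)

theorem monovary_sumElim {r s k : ℕ} {d g : Fin r → ℝ} {e : Fin s → ℝ} {c₀ : ℝ}
    (hdg : Monovary d g) (hge : ∀ l, k ≤ {i | e l ≤ g i}.ncard)
    (hle : ∀ l, k ≤ {i | g i ≤ e l}.ncard) (hgt : {i | c₀ < d i}.ncard ≤ k)
    (hlt : {i | d i < c₀}.ncard ≤ k) :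
    Monovary (Sum.elim d fun _ => c₀) (Sum.elim g e) := by
  rintro (i | l) (j | l') hij <;> simp only [Sum.elim_inl, Sum.elim_inr] at hij ⊢
  · exact hdg hij
  · by_contra! hi
    have hss : {i | e l' ≤ g i} ⊂ {i | c₀ < d i} :=
      (Set.ssubset_iff_of_subset fun i' hi' => hi.trans_le (hdg (hij.trans_le hi'))).2
        ⟨i, hi, not_le.2 hij⟩
    exact absurd (Set.ncard_lt_ncard hss) (not_lt.2 (hgt.trans (hge l')))
  · by_contra! hj
    have hss : {i | g i ≤ e l} ⊂ {i | d i < c₀} :=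
      (Set.ssubset_iff_of_subset fun i' hi' =>
        (hdg (lt_of_le_of_lt (show g i' ≤ e l from hi') hij)).trans_lt hj).2 ⟨j, hj, not_le.2 hij⟩
    exact absurd (Set.ncard_lt_ncard hss) (not_lt.2 (hlt.trans (hle l)))
  · exact le_rfl

variable {E : Type*} [NormedAddCommGroup E] [InnerProductSpace ℂ E]

theorem orthonormal_sumElim {ι κ : Type*} {x : ι → E} {y : κ → E} (hx : Orthonormal ℂ x)
    (hy : Orthonormal ℂ y) (hxy : ∀ i l, inner ℂ (x i) (y l) = 0) :
    Orthonormal ℂ (Sum.elim x y) := by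
  refine ⟨?_, ?_⟩
  · rintro (i | l)
    · exact hx.1 i
    · exact hy.1 l
  · rintro (i | l) (j | l') hne
    · exact hx.2 fun h => hne (by rw [h])
    · exact hxy i l'
    · exact inner_eq_zero_symm.1 (hxy j l)
    · exact hy.2 fun h => hne (by rw [h])

variable {κ κ' : Type*} [Fintype κ] [Fintype κ'] {m : ℕ} {T : Fin m → E →ₗ[ℂ] E}

theorem orthoRange_comp_equiv (e : κ ≃ κ') (c : κ' → ℝ) :
    orthoRange T (c ∘ e) = orthoRange T c := by
  ext p
  constructor
  · rintro ⟨y, hy, hp⟩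
    refine ⟨y ∘ e.symm, hy.comp _ e.symm.injective, fun j => ?_⟩
    rw [hp, ← Equiv.sum_comp e]
    simp
  · rintro ⟨y, hy, hp⟩
    refine ⟨y ∘ e, hy.comp _ e.injective, fun j => ?_⟩
    rw [hp, ← Equiv.sum_comp e]
    rfl

variable {r s k : ℕ}

namespace CommonEigenbasis

variable (B : CommonEigenbasis T r s)

theorem card_eq_finrank (B : CommonEigenbasis T r s) :
    Fintype.card (Fin r ⊕ Fin s) = Module.finrank ℂ E :=
  (Module.finrank_eq_card_basis B.basis.toBasis).symm

theorem orthonormal_inl : Orthonormal ℂ fun i => B.basis (Sum.inl i) :=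
  B.basis.orthonormal.comp _ Sum.inl_injective

theorem exists_eigenbasis_pencil [FiniteDimensional ℂ E] (hT : ∀ j, (T j).IsSymmetric)
    (θ : Fin m → ℝ) :
    ∃ (f : OrthonormalBasis (Fin r ⊕ Fin s) ℂ E) (e : Fin s → ℝ),
      (∀ i, f (Sum.inl i) = B.basis (Sum.inl i)) ∧ (∀ l, f (Sum.inr l) ∈ B.tail) ∧
        ∀ l, pencil T θ (f (Sum.inr l)) = (e l : ℂ) • f (Sum.inr l) := by
  have hinv : ∀ x ∈ B.tail, pencil T θ x ∈ B.tail := fun x hx =>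
    pencil_mem (B.tail_invariant hT) θ x hx
  have hsym := (pencil_isSymmetric hT θ).restrict_invariant hinv
  set v := hsym.eigenvectorBasis B.finrank_tail with hv
  have hortho : Orthonormal ℂ
      (Sum.elim (fun i => B.basis (Sum.inl i)) fun l => (v l : E)) :=
    orthonormal_sumElim B.orthonormal_inl (v.orthonormal.comp_linearIsometry B.tail.subtypeₗᵢ)
      fun i l => B.mem_tail.1 (v l).2 i
  obtain ⟨f, hf⟩ := exists_orthonormalBasis_of_orthonormal hortho B.card_eq_finrank
  refine ⟨f, hsym.eigenvalues B.finrank_tail, fun i => by rw [hf]; rfl,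
    fun l => by rw [hf]; exact (v l).2, fun l => ?_⟩
  rw [hf]
  exact congrArg Subtype.val (hsym.apply_eigenvectorBasis B.finrank_tail l)

theorem sum_quadForm_inr {θ : Fin m → ℝ} {f : OrthonormalBasis (Fin r ⊕ Fin s) ℂ E}
    {e : Fin s → ℝ} (hf : ∀ i, f (Sum.inl i) = B.basis (Sum.inl i))
    (hft : ∀ l, f (Sum.inr l) ∈ B.tail)
    (he : ∀ l, pencil T θ (f (Sum.inr l)) = (e l : ℂ) • f (Sum.inr l)) :
    ∑ l, quadForm (pencil T θ) (B.basis (Sum.inr l)) = ∑ l, e l := by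
  have hfh : ∀ l, pencil T θ (f l) = ((Sum.elim (fun i => θ ⬝ᵥ B.a i) e l : ℝ) : ℂ) • f l := by
    rintro (i | l)
    · rw [hf, B.pencil_inl, Sum.elim_inl]
    · rw [he, Sum.elim_inr]
  have h0 : ∀ i l, inner ℂ (f (Sum.inl i)) (B.basis (Sum.inr l)) = 0 := fun i l => by
    rw [hf]
    exact B.mem_tail.1 (B.inr_mem_tail l) i
  have h1 : ∀ l, ∑ l', ‖inner ℂ (f (Sum.inr l)) (B.basis (Sum.inr l'))‖ ^ 2 = 1 := by
    intro l
    have h := B.basis.sum_sq_norm_inner_left (f (Sum.inr l))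
    rw [f.orthonormal.1, Fintype.sum_sum_type, one_pow] at h
    rw [← h, right_eq_add]
    refine Finset.sum_eq_zero fun i _ => ?_
    rw [inner_eq_zero_symm.1 (B.mem_tail.1 (hft l) i)]
    simp
  calc ∑ l, quadForm (pencil T θ) (B.basis (Sum.inr l))
      = ∑ l, ∑ l', ‖inner ℂ (f (Sum.inr l')) (B.basis (Sum.inr l))‖ ^ 2 * e l' := by
        refine Finset.sum_congr rfl fun l _ => ?_
        rw [quadForm_eq_sum_of_eigenbasis f hfh, Fintype.sum_sum_type]
        simp [h0]
    _ = ∑ l, e l := by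
        rw [Finset.sum_comm]
        simp only [← Finset.sum_mul, h1, one_mul]

theorem quadForm_of_mem_head {x : E} (hx : x ∈ B.head) (j : Fin m) :
    quadForm (T j) x = ∑ i, ‖inner ℂ (B.basis (Sum.inl i)) x‖ ^ 2 * B.a i j := by
  have h0 : ∀ l, inner ℂ (B.basis (Sum.inr l)) x = 0 := fun l =>
    inner_eq_zero_symm.1 (Submodule.inner_right_of_mem_orthogonal hx (B.inr_mem_tail l))
  have hx' : T j x = ∑ i, (inner ℂ (B.basis (Sum.inl i)) x * B.a i j) •
      B.basis (Sum.inl i) := by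
    conv_lhs => rw [← B.basis.sum_repr' x]
    simp [Fintype.sum_sum_type, h0, B.eigen, smul_smul, -Complex.coe_smul]
  rw [quadForm, hx', inner_sum, Complex.re_sum]
  refine Finset.sum_congr rfl fun i _ => ?_
  rw [inner_smul_right, ← inner_conj_symm x, mul_right_comm, Complex.mul_conj,
    Complex.normSq_eq_norm_sq, ← Complex.ofReal_mul, Complex.ofReal_re]

/-- The point of the numerical range with weights `c` on the common eigenvectors and `c₀` on their
orthogonal complement. -/
noncomputable def vertex (c : Fin r → ℝ) (c₀ : ℝ) (j : Fin m) : ℝ :=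
  ∑ i, c i * B.a i j + c₀ * ∑ l, quadForm (T j) (B.basis (Sum.inr l))

theorem dotProduct_vertex (c : Fin r → ℝ) (c₀ : ℝ) (θ : Fin m → ℝ) :
    θ ⬝ᵥ B.vertex c c₀ = ∑ i, c i * (θ ⬝ᵥ B.a i) +
      c₀ * ∑ l, quadForm (pencil T θ) (B.basis (Sum.inr l)) := by
  simp only [dotProduct, vertex, quadForm_pencil, mul_add, Finset.sum_add_distrib, Finset.mul_sum]
  congr 1
  · rw [Finset.sum_comm]
    exact Finset.sum_congr rfl fun _ _ => Finset.sum_congr rfl fun _ _ => by ring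
  · rw [Finset.sum_comm]
    exact Finset.sum_congr rfl fun _ _ => Finset.sum_congr rfl fun _ _ => by ring

theorem vertex_mem_orthoRange {c d : Fin r → ℝ} (c₀ : ℝ)
    (hd : d ∈ diagonals (fun i => B.basis (Sum.inl i)) c) :
    B.vertex d c₀ ∈ orthoRange T (Sum.elim c fun _ : Fin s => c₀) := by
  obtain ⟨y, hy, hyb, hdy⟩ := hd
  refine ⟨Sum.elim y fun l => B.basis (Sum.inr l), orthonormal_sumElim hy
    (B.basis.orthonormal.comp _ Sum.inr_injective) fun i l =>
      Submodule.inner_right_of_mem_orthogonal (hyb i) (B.inr_mem_tail l), fun j => ?_⟩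
  rw [Fintype.sum_sum_type, vertex]
  simp only [Sum.elim_inl, Sum.elim_inr, B.quadForm_of_mem_head (hyb _), hdy, Finset.mul_sum,
    Finset.sum_mul]
  rw [Finset.sum_comm]
  simp only [mul_assoc]

theorem convexHull_vertex_subset (c : Fin r → ℝ) (c₀ : ℝ) :
    convexHull ℝ (Set.range fun σ : Equiv.Perm (Fin r) => B.vertex (c ∘ σ) c₀) ⊆
      orthoRange T (Sum.elim c fun _ : Fin s => c₀) := by
  set P := convexHull ℝ (Set.range fun σ : Equiv.Perm (Fin r) => c ∘ σ) with hP
  have hconv : Convex ℝ ((fun d => B.vertex d c₀) '' P) := by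
    rintro _ ⟨d, hd, rfl⟩ _ ⟨d', hd', rfl⟩ α β hα hβ hαβ
    refine ⟨α • d + β • d', convex_convexHull ℝ _ hd hd' hα hβ hαβ, ?_⟩
    funext j
    simp only [vertex, Pi.add_apply, Pi.smul_apply, smul_eq_mul, add_mul, Finset.sum_add_distrib,
      mul_assoc, ← Finset.mul_sum]
    linear_combination -(c₀ * ∑ l, quadForm (T j) (B.basis (Sum.inr l))) * hαβ
  refine (convexHull_min ?_ hconv).trans ?_
  · rintro _ ⟨σ, rfl⟩
    exact ⟨_, subset_convexHull ℝ _ ⟨σ, rfl⟩, rfl⟩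
  · rintro _ ⟨d, hd, rfl⟩
    exact B.vertex_mem_orthoRange c₀ (convexHull_perm_subset_diagonals B.orthonormal_inl c hd)

theorem orthoRange_subset_convexHull_vertex [FiniteDimensional ℂ E]
    (hT : ∀ j, (T j).IsSymmetric) (F : SplitFan T k) (hk : 2 * k ≤ Module.finrank ℂ E)
    {c : Fin r → ℝ} {c₀ : ℝ} (hgt : {i | c₀ < c i}.ncard ≤ k) (hlt : {i | c i < c₀}.ncard ≤ k) :
    orthoRange T (Sum.elim c fun _ : Fin s => c₀) ⊆
      convexHull ℝ (Set.range fun σ : Equiv.Perm (Fin r) => B.vertex (c ∘ σ) c₀) := by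
  intro p hp
  by_contra hnot
  obtain ⟨φ, u, hφ, hu⟩ := geometric_hahn_banach_closed_point (convex_convexHull ℝ _)
    ((Set.finite_range _).isCompact_convexHull (𝕜 := ℝ)).isClosed hnot
  obtain ⟨θ, hθ⟩ := exists_dotProduct_eq φ
  obtain ⟨σ, hσ⟩ := exists_perm_monovary c fun i => θ ⬝ᵥ B.a i
  obtain ⟨f, e, hf, hft, he⟩ := B.exists_eigenbasis_pencil hT θ
  have hfh : ∀ l, pencil T θ (f l) = ((Sum.elim (fun i => θ ⬝ᵥ B.a i) e l : ℝ) : ℂ) • f l := by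
    rintro (i | l)
    · rw [hf, B.pencil_inl, Sum.elim_inl]
    · rw [he, Sum.elim_inr]
  have hcard : ∀ q : ℝ → Prop, {i | q ((c ∘ σ) i)}.ncard = {i | q (c i)}.ncard := fun q =>
    Set.ncard_preimage_of_injective_subset_range (s := {i | q (c i)}) σ.injective
      (by simp [σ.surjective.range_eq])
  have hmono : Monovary (Sum.elim (c ∘ σ) fun _ : Fin s => c₀)
      (Sum.elim (fun i => θ ⬝ᵥ B.a i) e) :=
    monovary_sumElim hσ
      (fun l => B.le_ncard_of_eigen hT F hk (hft l) (f.orthonormal.ne_zero _) (he l))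
      (fun l => B.le_ncard_of_eigen' hT F hk (hft l) (f.orthonormal.ne_zero _) (he l))
      ((hcard fun t => c₀ < t).trans_le hgt) ((hcard fun t => t < c₀).trans_le hlt)
  have hp' : p ∈ orthoRange T (Sum.elim (c ∘ σ) fun _ : Fin s => c₀) := by
    rw [← orthoRange_comp_equiv (Equiv.sumCongr σ (Equiv.refl (Fin s)))] at hp
    convert hp using 2
    ext (i | l) <;> rfl
  obtain ⟨y, hy, hpy⟩ := hp'
  obtain ⟨b, rfl⟩ := exists_orthonormalBasis_of_orthonormal hy B.card_eq_finrank
  have h1 := sum_quadForm_le_of_monovary f b hfh hmono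
  rw [← dotProduct_orthoRange hpy θ, Fintype.sum_sum_type] at h1
  simp only [Sum.elim_inl, Sum.elim_inr] at h1
  rw [← Finset.mul_sum, ← B.sum_quadForm_inr hf hft he, ← B.dotProduct_vertex, ← hθ, ← hθ] at h1
  exact absurd (hφ _ (subset_convexHull ℝ _ ⟨σ, rfl⟩)) (not_lt.2 (hu.le.trans h1))

end CommonEigenbasis

theorem isPolyhedral_orthoRange [FiniteDimensional ℂ E] (hT : ∀ j, (T j).IsSymmetric)
    (F : SplitFan T k)
    (hk : 2 * k ≤ Module.finrank ℂ E) (hcard : Fintype.card κ = Module.finrank ℂ E) {c : κ → ℝ}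
    {c₀ : ℝ} (hgt : {i | c₀ < c i}.ncard ≤ k) (hlt : {i | c i < c₀}.ncard ≤ k) :
    IsPolyhedral (orthoRange T c) := by
  classical
  obtain ⟨r, s, ⟨B⟩⟩ := exists_commonEigenbasis T
  have hr := B.two_mul_le hT F hk
  have hrs := B.card_eq_finrank
  rw [Fintype.card_sum, Fintype.card_fin, Fintype.card_fin] at hrs
  obtain ⟨S, hS, hSr⟩ : ∃ S : Finset κ, (∀ i, c i ≠ c₀ → i ∈ S) ∧ S.card = r := by
    have h : (Finset.univ.filter fun i => c i ≠ c₀).card ≤ r := by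
      have e : ((Finset.univ.filter fun i => c i ≠ c₀ : Finset κ) : Set κ) =
          {i | c₀ < c i} ∪ {i | c i < c₀} := by
        ext i
        simp [lt_or_lt_iff_ne, ne_comm]
      rw [← Set.ncard_coe_finset, e]
      refine (Set.ncard_union_le _ _).trans ?_
      omega
    obtain ⟨S, hS, hSr⟩ := Finset.exists_superset_card_eq h
      (by rw [hcard]; omega)
    exact ⟨S, fun i hi => hS (by simpa using hi), hSr⟩
  have e₁ : {i // i ∈ S} ≃ Fin r := Fintype.equivFinOfCardEq (by simpa using hSr)
  have e₂ : {i // i ∉ S} ≃ Fin s := Fintype.equivFinOfCardEq (by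
    rw [Fintype.card_subtype_compl, Fintype.card_coe, hSr, hcard]
    omega)
  set e : Fin r ⊕ Fin s ≃ κ := (Equiv.sumCongr e₁ e₂).symm.trans (Equiv.sumCompl (· ∈ S)) with he
  have hce : c ∘ e = Sum.elim (fun i => c (e (Sum.inl i))) fun _ : Fin s => c₀ := by
    funext l
    rcases l with i | l
    · rfl
    · by_contra hne
      exact (e₂.symm l).2 (hS _ hne)
  have hinj : Function.Injective fun i : Fin r => e (Sum.inl i) :=
    e.injective.comp Sum.inl_injective
  have hsub : ∀ q : ℝ → Prop, {i | q (c (e (Sum.inl i)))}.ncard ≤ {i | q (c i)}.ncard := fun q =>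
    Set.ncard_le_ncard_of_injOn (fun i => e (Sum.inl i)) (fun _ h => h) hinj.injOn
  rw [← orthoRange_comp_equiv e, hce]
  exact ⟨_, Set.finite_range _, (B.orthoRange_subset_convexHull_vertex hT F hk
    ((hsub fun t => c₀ < t).trans hgt) ((hsub fun t => t < c₀).trans hlt)).antisymm
    (B.convexHull_vertex_subset _ c₀)⟩

end Conclusion

section Matrices

variable {n m : ℕ}

theorem orthonormal_col_iff (W : Matrix (Fin n) (Fin n) ℂ) :
    (Orthonormal ℂ fun i => WithLp.toLp 2 (W.col i)) ↔ W ∈ unitaryGroup (Fin n) ℂ := by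
  rw [orthonormal_iff_ite, mem_unitaryGroup_iff', ← Matrix.ext_iff]
  refine forall_congr' fun i => forall_congr' fun j => ?_
  rw [EuclideanSpace.inner_toLp_toLp, dotProduct_comm, one_apply]
  rfl

theorem trace_diagonal_conj (d : Fin n → ℝ) {H : Matrix (Fin n) (Fin n) ℂ} (hH : H.IsHermitian)
    (W : Matrix (Fin n) (Fin n) ℂ) :
    (diagonal (fun i => (d i : ℂ)) * (star W * H * W)).trace =
      ((∑ i, d i * quadForm (toEuclideanLin H) (WithLp.toLp 2 (W.col i)) : ℝ) : ℂ) := by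
  push_cast
  refine Finset.sum_congr rfl fun i _ => ?_
  have h := (isSymmetric_toEuclideanLin_iff.2 hH).coe_re_inner_self_apply (WithLp.toLp 2 (W.col i))
  rw [diag_apply, diagonal_mul]
  congr 1
  refine Eq.trans ?_ h.symm
  rw [toLpLin_toLp, EuclideanSpace.inner_toLp_toLp, dotProduct_comm, toLin'_apply, mul_assoc]
  rfl

theorem jointCNumRangeR_eq_orthoRange {C : Matrix (Fin n) (Fin n) ℂ} (hC : C.IsHermitian)
    {A : Fin m → Matrix (Fin n) (Fin n) ℂ} (hA : ∀ j, (A j).IsHermitian) :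
    jointCNumRangeR C A = orthoRange (fun j => toEuclideanLin (A j)) hC.eigenvalues := by
  obtain ⟨V, hV, hCV⟩ : ∃ V ∈ unitaryGroup (Fin n) ℂ,
      C = V * diagonal (fun i => (hC.eigenvalues i : ℂ)) * star V :=
    ⟨hC.eigenvectorUnitary, hC.eigenvectorUnitary.2, hC.spectral_theorem⟩
  have htr : ∀ (U : Matrix (Fin n) (Fin n) ℂ) j, (C * (star U * A j * U)).trace =
      ((∑ i, hC.eigenvalues i *
        quadForm (toEuclideanLin (A j)) (WithLp.toLp 2 ((U * V).col i)) : ℝ) : ℂ) := by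
    intro U j
    rw [← trace_diagonal_conj _ (hA j), star_mul]
    conv_lhs => rw [hCV]
    rw [mul_assoc, mul_assoc, trace_mul_comm]
    simp only [mul_assoc]
  ext p
  constructor
  · rintro ⟨U, hU, hp⟩
    refine ⟨_, (orthonormal_col_iff (U * V)).2 (mul_mem hU hV), fun j => ?_⟩
    exact_mod_cast (hp j).trans (htr U j)
  · rintro ⟨y, hy, hp⟩
    set W : Matrix (Fin n) (Fin n) ℂ := Matrix.of fun a i => y i a with hW
    have hWy : (fun i => WithLp.toLp 2 (W.col i)) = y := rfl
    have hWV : W * star V * V = W := by rw [mul_assoc, mem_unitaryGroup_iff'.1 hV, mul_one]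
    refine ⟨W * star V, mul_mem ((orthonormal_col_iff W).1 (hWy ▸ hy)) (Unitary.star_mem hV),
      fun j => ?_⟩
    rw [htr, hWV, hp]
    rfl

theorem exists_eigDesc_eq {C : Matrix (Fin n) (Fin n) ℂ} (hC : C.IsHermitian) :
    ∃ π : Equiv.Perm (Fin n), eigDesc C = hC.eigenvalues ∘ π := by
  refine ⟨Fin.revPerm.trans (Tuple.sort hC.eigenvalues), ?_⟩
  rw [eigDesc, dif_pos hC]
  rfl

theorem antitone_eigDesc {C : Matrix (Fin n) (Fin n) ℂ} (hC : C.IsHermitian) :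
    Antitone (eigDesc C) := by
  rw [eigDesc, dif_pos hC]
  exact fun i j hij => Tuple.monotone_sort hC.eigenvalues (Fin.rev_le_rev.2 hij)

theorem jointCNumRangeR_eq_orthoRange_eigDesc {C : Matrix (Fin n) (Fin n) ℂ}
    (hC : C.IsHermitian) {A : Fin m → Matrix (Fin n) (Fin n) ℂ} (hA : ∀ j, (A j).IsHermitian) :
    jointCNumRangeR C A = orthoRange (fun j => toEuclideanLin (A j)) (eigDesc C) := by
  obtain ⟨π, hπ⟩ := exists_eigDesc_eq hC
  rw [hπ, orthoRange_comp_equiv, jointCNumRangeR_eq_orthoRange hC hA]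

theorem eq_smul_one_of_eigDesc_const {C : Matrix (Fin n) (Fin n) ℂ} (hC : C.IsHermitian) {a : ℝ}
    (h : ∀ i, eigDesc C i = a) : C = (a : ℂ) • (1 : Matrix (Fin n) (Fin n) ℂ) := by
  obtain ⟨π, hπ⟩ := exists_eigDesc_eq hC
  have he : ∀ i, hC.eigenvalues i = a := fun i => by
    rw [← h (π.symm i), hπ, Function.comp_apply, Equiv.apply_symm_apply]
  have hd : diagonal (RCLike.ofReal ∘ hC.eigenvalues) =
      (a : ℂ) • (1 : Matrix (Fin n) (Fin n) ℂ) := by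
    rw [smul_one_eq_diagonal]
    exact congrArg diagonal (funext fun i => congrArg Complex.ofReal (he i))
  conv_lhs => rw [hC.spectral_theorem, hd, map_smul, map_one]

/-- The index set whose supremum is `gammaC C`. -/
def gapSet (C : Matrix (Fin n) (Fin n) ℂ) : Set ℕ :=
  { t : ℕ | ∃ (j : ℕ) (h1 : 1 ≤ j) (h2 : j < n),
    eigDesc C ⟨j - 1, by omega⟩ > eigDesc C ⟨j, h2⟩ ∧
    ((t = j ∧ 2 * j ≤ n) ∨ (t = n - j ∧ 2 * (n - j) ≤ n)) }

theorem bddAbove_gapSet (C : Matrix (Fin n) (Fin n) ℂ) : BddAbove (gapSet C) :=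
  ⟨n, by rintro t ⟨j, -, hj, -, h | h⟩ <;> omega⟩

theorem le_gammaC {C : Matrix (Fin n) (Fin n) ℂ} {t : ℕ} (h : t ∈ gapSet C) : t ≤ gammaC C :=
  le_csSup (bddAbove_gapSet C) h

theorem gapSet_nonempty {C : Matrix (Fin n) (Fin n) ℂ} (hC : C.IsHermitian)
    (hCns : ∀ a : ℝ, C ≠ (a : ℂ) • (1 : Matrix (Fin n) (Fin n) ℂ)) : (gapSet C).Nonempty := by
  by_contra hempty
  have hstep : ∀ (j : ℕ) (h1 : 1 ≤ j) (h2 : j < n),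
      eigDesc C ⟨j - 1, by omega⟩ ≤ eigDesc C ⟨j, h2⟩ := by
    intro j h1 h2
    by_contra! hlt
    refine hempty ?_
    rcases le_total (2 * j) n with h | h
    · exact ⟨j, j, h1, h2, hlt, Or.inl ⟨rfl, h⟩⟩
    · exact ⟨n - j, j, h1, h2, hlt, Or.inr ⟨rfl, by omega⟩⟩
  rcases Nat.eq_zero_or_pos n with rfl | hn
  · exact hCns 0 (Subsingleton.elim _ _)
  refine hCns _ (eq_smul_one_of_eigDesc_const hC (a := eigDesc C ⟨0, hn⟩) ?_)
  have hle : ∀ (j : ℕ) (h : j < n), eigDesc C ⟨0, hn⟩ ≤ eigDesc C ⟨j, h⟩ := by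
    intro j
    induction j with
    | zero => exact fun _ => le_rfl
    | succ j ih => exact fun h => (ih (by omega)).trans (hstep (j + 1) (by omega) h)
  exact fun i => le_antisymm (antitone_eigDesc hC (Nat.zero_le i.1)) (hle i.1 i.2)

theorem ncard_val_lt {j : ℕ} (hj : j ≤ n) : {i : Fin n | i.1 < j}.ncard = j := by
  rw [Set.ncard_eq_toFinset_card', Set.toFinset_ofPred, Fin.card_filter_val_lt, min_eq_right hj]

theorem ncard_le_val {j : ℕ} (hj : j ≤ n) : {i : Fin n | j ≤ i.1}.ncard = n - j := by
  have h := Set.ncard_add_ncard_compl {i : Fin n | i.1 < j}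
  rw [ncard_val_lt hj, Nat.card_eq_fintype_card, Fintype.card_fin] at h
  rw [show {i : Fin n | j ≤ i.1} = {i : Fin n | i.1 < j}ᶜ by ext i; simp]
  omega

theorem IsPolyhedral.neg {S : Set (Fin m → ℝ)} (hS : IsPolyhedral S) : IsPolyhedral (-S) := by
  obtain ⟨F, hF, rfl⟩ := hS
  exact ⟨-F, hF.neg, (convexHull_neg F).symm⟩

theorem orthoRange_neg {E κ : Type*} [NormedAddCommGroup E] [InnerProductSpace ℂ E] [Fintype κ]
    (T : Fin m → E →ₗ[ℂ] E) (c : κ → ℝ) : orthoRange T (-c) = -orthoRange T c := by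
  ext p
  refine exists_congr fun y => and_congr_right fun _ => forall_congr' fun j => ?_
  simp [eq_neg_iff_add_eq_zero, neg_eq_iff_add_eq_zero]

theorem exists_splitFan_gammaC {C : Matrix (Fin n) (Fin n) ℂ} (hC : C.IsHermitian)
    (hCns : ∀ a : ℝ, C ≠ (a : ℂ) • (1 : Matrix (Fin n) (Fin n) ℂ))
    {A : Fin m → Matrix (Fin n) (Fin n) ℂ} (hA : ∀ j, (A j).IsHermitian)
    (hpoly : IsPolyhedral (convexHull ℝ (jointCNumRangeR C A))) :
    Nonempty (SplitFan (fun j => toEuclideanLin (A j)) (gammaC C)) := by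
  have hT : ∀ j, (toEuclideanLin (A j)).IsSymmetric := fun j =>
    isSymmetric_toEuclideanLin_iff.2 (hA j)
  have hcard : Fintype.card (Fin n) = Module.finrank ℂ (EuclideanSpace ℂ (Fin n)) :=
    finrank_euclideanSpace.symm
  rw [jointCNumRangeR_eq_orthoRange_eigDesc hC hA] at hpoly
  obtain ⟨j, h1, h2, hgap, hj⟩ := Nat.sSup_mem (gapSet_nonempty hC hCns) (bddAbove_gapSet C)
  have hanti := antitone_eigDesc hC
  rcases hj with ⟨hj, -⟩ | ⟨hj, -⟩
  · have h := exists_splitFan hT hcard hpoly (eigDesc C ⟨j, h2⟩)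
    rw [show {i | eigDesc C ⟨j, h2⟩ < eigDesc C i} = {i : Fin n | i.1 < j} by
      ext i
      rw [Set.mem_ofPred, Set.mem_ofPred]
      refine ⟨fun hi => not_le.1 fun hij => not_lt.2 (hanti ?_) hi, fun hi => ?_⟩
      · exact hij
      · exact hgap.trans_le (hanti (Nat.le_sub_one_of_lt hi)), ncard_val_lt h2.le, ← hj] at h
    exact h
  · have hneg : IsPolyhedral (convexHull ℝ
        (orthoRange (fun j => toEuclideanLin (A j)) (-eigDesc C))) := by
      rw [orthoRange_neg, convexHull_neg]
      exact hpoly.neg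
    have h := exists_splitFan hT hcard hneg (-eigDesc C ⟨j - 1, by omega⟩)
    rw [show {i | -eigDesc C ⟨j - 1, by omega⟩ < (-eigDesc C) i} = {i : Fin n | j ≤ i.1} by
      ext i
      rw [Set.mem_ofPred, Set.mem_ofPred, Pi.neg_apply, neg_lt_neg_iff]
      refine ⟨fun hi => not_lt.1 fun hij => not_lt.2 (hanti ?_) hi, fun hi => ?_⟩
      · exact Nat.le_sub_one_of_lt hij
      · exact (hanti (show (⟨j, h2⟩ : Fin n) ≤ i from hi)).trans_lt hgap, ncard_le_val h2.le,
      ← hj] at h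
    exact h

theorem exists_level_of_gammaC_le {C : Matrix (Fin n) (Fin n) ℂ} (hC : C.IsHermitian) {k : ℕ}
    (hk : k < n) (hCk : gammaC C ≤ k) :
    ∃ c₀, {i | c₀ < eigDesc C i}.ncard ≤ k ∧ {i | eigDesc C i < c₀}.ncard ≤ k := by
  have hanti := antitone_eigDesc hC
  refine ⟨eigDesc C ⟨k, hk⟩, ?_, ?_⟩
  · refine (Set.ncard_le_ncard fun i hi => ?_).trans_eq (ncard_val_lt hk.le)
    exact not_le.1 fun hki => not_lt.2 (hanti (show (⟨k, hk⟩ : Fin n) ≤ i from hki)) hi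
  · rcases Set.eq_empty_or_nonempty {i | eigDesc C i < eigDesc C ⟨k, hk⟩} with h | h
    · rw [h, Set.ncard_empty]
      exact Nat.zero_le k
    obtain ⟨p, hp⟩ := (Set.toFinite _).exists_minimal h
    have hkp : k < p.1 := not_le.1 fun h => not_lt.2 (hanti (Fin.mk_le_mk.2 h)) hp.1
    have hsub : {i | eigDesc C i < eigDesc C ⟨k, hk⟩} ⊆ {i : Fin n | p.1 ≤ i.1} := fun i hi =>
      not_lt.1 fun hip => hp.not_lt (y := i) hi hip
    have hgap : eigDesc C ⟨p.1 - 1, by omega⟩ > eigDesc C ⟨p.1, p.2⟩ :=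
      hp.1.trans_le <| not_lt.1 fun hlt => by
        have := hsub hlt
        simp only [Set.mem_ofPred] at this
        omega
    refine (Set.ncard_le_ncard hsub).trans ?_
    rw [ncard_le_val p.2.le]
    refine le_trans ?_ hCk
    rcases le_total (2 * p.1) n with h | h
    · have := le_gammaC (C := C) ⟨p.1, by omega, p.2, hgap, Or.inl ⟨rfl, h⟩⟩
      omega
    · exact le_gammaC ⟨p.1, by omega, p.2, hgap, Or.inr ⟨rfl, by omega⟩⟩

end Matrices

theorem stmt_17 {n m : ℕ} (hm : 0 < m)
    (A : Fin m → Matrix (Fin n) (Fin n) ℂ) (hA : ∀ j, (A j).IsHermitian)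
    (C : Matrix (Fin n) (Fin n) ℂ) (hC : C.IsHermitian)
    (hCns : ∀ a : ℝ, C ≠ (a : ℂ) • (1 : Matrix (Fin n) (Fin n) ℂ))
    (hγ : 2 * gammaC C ≤ n)
    (hpoly : IsPolyhedral (convexHull ℝ (jointCNumRangeR C A))) :
    (∀ C' : Matrix (Fin n) (Fin n) ℂ, C'.IsHermitian →
      (∀ a : ℝ, C' ≠ (a : ℂ) • (1 : Matrix (Fin n) (Fin n) ℂ)) →
      gammaC C' ≤ gammaC C → IsPolyhedral (jointCNumRangeR C' A)) ∧
    IsPolyhedral (jointCNumRangeR C A) := by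
  obtain ⟨F⟩ := exists_splitFan_gammaC hC hCns hA hpoly
  have hrank : Module.finrank ℂ (EuclideanSpace ℂ (Fin n)) = n := finrank_euclideanSpace_fin
  have hkn : gammaC C < n := by
    rcases Nat.eq_zero_or_pos n with rfl | hn
    · exact absurd (Subsingleton.elim C _) (hCns 0)
    · omega
  have key : ∀ C' : Matrix (Fin n) (Fin n) ℂ, C'.IsHermitian → gammaC C' ≤ gammaC C →
      IsPolyhedral (jointCNumRangeR C' A) := by
    intro C' hC' hle
    obtain ⟨c₀, hgt, hlt⟩ := exists_level_of_gammaC_le hC' hkn hle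
    rw [jointCNumRangeR_eq_orthoRange_eigDesc hC' hA]
    exact isPolyhedral_orthoRange (fun j => isSymmetric_toEuclideanLin_iff.2 (hA j)) F
      (by rw [hrank]; exact hγ) (by rw [hrank, Fintype.card_fin]) hgt hlt
  exact ⟨fun C' hC' _ => key C' hC', key C hC le_rfl⟩
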